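/- Let G be a simple graph on 13 vertices with minimum degree at least 6 and exactly 42 edges. Then either G contains K6 as a minor, or G is isomorphic to the join K1 ∗ Ic of a single vertex with the icosahedral graph. -/

import Mathlib

open SimpleGraph

/-- `H` is a minor of `G`: there is an assignment of (some) vertices of `G` to
branch sets, one nonempty connected branch set for each vertex of `H`, such that
every edge of `H` is realized by an edge of `G` between the corresponding branch sets. -/
def IsMinor {V W : Type} (H : SimpleGraph W) (G : SimpleGraph V) : Prop :=
  ∃ f : V → Option W,
    (∀ w : W, ∃ v, f v = some w) ∧
    (∀ w : W, (G.induce {v | f v = some w}).Connected) ∧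
    (∀ w₁ w₂ : W, H.Adj w₁ w₂ →
      ∃ v₁ v₂, f v₁ = some w₁ ∧ f v₂ = some w₂ ∧ G.Adj v₁ v₂)

/-- Planarity via Wagner's theorem: no `K₅` minor and no `K₃,₃` minor. -/
def IsPlanar {V : Type} (G : SimpleGraph V) : Prop :=
  ¬ IsMinor (completeGraph (Fin 5)) G ∧
    ¬ IsMinor (completeBipartiteGraph (Fin 3) (Fin 3)) G

/-- A graph is apex if deleting some vertex leaves a planar graph. -/
def IsApex {V : Type} (G : SimpleGraph V) : Prop :=
  ∃ v : V, IsPlanar (G.induce {u | u ≠ v})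

/-- Minor minimal non-apex: not apex, but every proper minor is apex. -/
def IsMMNA {V : Type} (G : SimpleGraph V) : Prop :=
  ¬ IsApex G ∧
    ∀ (W : Type) (H : SimpleGraph W), IsMinor H G → ¬ IsMinor G H → IsApex H

/-- The degree of a vertex, as the cardinality of its neighbor set. -/
noncomputable def vdeg {V : Type} (G : SimpleGraph V) (v : V) : ℕ :=
  (G.neighborSet v).ncard

/-- Edge list of the icosahedral graph on 12 vertices. -/
def icList : List (Fin 12 × Fin 12) :=
  [(0,1),(0,2),(0,3),(0,4),(0,5),
   (1,2),(2,3),(3,4),(4,5),(5,1),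
   (11,6),(11,7),(11,8),(11,9),(11,10),
   (6,7),(7,8),(8,9),(9,10),(10,6),
   (1,6),(1,7),(2,7),(2,8),(3,8),(3,9),(4,9),(4,10),(5,10),(5,6)]

/-- The icosahedral graph `Ic`. -/
def Ic : SimpleGraph (Fin 12) := SimpleGraph.fromRel (fun a b => (a, b) ∈ icList)

/-- The join `K₁ ∗ Ic`: a cone over the icosahedral graph. -/
def ConeIc : SimpleGraph (Unit ⊕ Fin 12) :=
  SimpleGraph.fromRel (fun a b =>
    a = Sum.inl () ∨ b = Sum.inl () ∨ ∃ x y, a = Sum.inr x ∧ b = Sum.inr y ∧ Ic.Adj x y)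

/-- `G` has a `K₆` minor. -/
abbrev HasK6 {V : Type} (G : SimpleGraph V) : Prop := IsMinor (completeGraph (Fin 6)) G

section Minors

variable {V : Type} {G : SimpleGraph V}

theorem hasK6_of_sets (B : Fin 6 → Set V) (hc : ∀ i, (G.induce (B i)).Connected)
    (hd : ∀ i j, i < j → Disjoint (B i) (B j))
    (ha : ∀ i j, i < j → ∃ x ∈ B i, ∃ y ∈ B j, G.Adj x y) : HasK6 G := by
  classical
  have hd' : ∀ i j v, v ∈ B i → v ∈ B j → i = j := by
    intro i j v hi hj
    rcases lt_trichotomy i j with h | h | h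
    · exact absurd hj (Set.disjoint_left.1 (hd i j h) hi)
    · exact h
    · exact absurd hi (Set.disjoint_left.1 (hd j i h) hj)
  let f : V → Option (Fin 6) := fun v => if h : ∃ i, v ∈ B i then some h.choose else none
  have hf : ∀ v i, f v = some i ↔ v ∈ B i := by
    intro v i
    by_cases h : ∃ i, v ∈ B i
    · have hs := h.choose_spec
      simp only [f, dif_pos h, Option.some.injEq]
      exact ⟨fun e => e ▸ hs, fun hi => hd' _ _ v hs hi⟩
    · simp only [f, dif_neg h]
      exact ⟨fun e => by simp at e, fun hi => absurd ⟨i, hi⟩ h⟩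
  refine ⟨f, fun w => ?_, fun w => ?_, fun w₁ w₂ hw => ?_⟩
  · obtain ⟨⟨x, hx⟩⟩ := (hc w).nonempty
    exact ⟨x, (hf x w).2 hx⟩
  · have : {v | f v = some w} = B w := by ext v; simp [hf]
    rw [this]; exact hc w
  · rcases lt_or_gt_of_ne hw with h | h
    · obtain ⟨x, hx, y, hy, hxy⟩ := ha _ _ h
      exact ⟨x, y, (hf _ _).2 hx, (hf _ _).2 hy, hxy⟩
    · obtain ⟨x, hx, y, hy, hxy⟩ := ha _ _ h
      exact ⟨y, x, (hf _ _).2 hy, (hf _ _).2 hx, hxy.symm⟩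

theorem HasK6.exists_sets (h : HasK6 G) : ∃ B : Fin 6 → Set V,
    (∀ i, (G.induce (B i)).Connected) ∧ (∀ i j, i ≠ j → Disjoint (B i) (B j)) ∧
    (∀ i j, i ≠ j → ∃ x ∈ B i, ∃ y ∈ B j, G.Adj x y) := by
  obtain ⟨f, -, hc, ha⟩ := h
  refine ⟨fun i => {v | f v = some i}, hc, fun i j hij => ?_, fun i j hij => ?_⟩
  · rw [Set.disjoint_left]
    intro v hi hj
    simp only [Set.mem_ofPred_eq] at hi hj
    exact hij (by simpa [hi] using hj)
  · obtain ⟨x, y, hx, hy, hxy⟩ := ha i j hij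
    exact ⟨x, hx, y, hy, hxy⟩

theorem HasK6.mono {G' : SimpleGraph V} (hle : G ≤ G') (h : HasK6 G) : HasK6 G' := by
  obtain ⟨f, hs, hc, ha⟩ := h
  refine ⟨f, hs, fun w => (hc w).mono fun a b hab => hle hab, fun w₁ w₂ hw => ?_⟩
  obtain ⟨x, y, hx, hy, hxy⟩ := ha w₁ w₂ hw
  exact ⟨x, y, hx, hy, hle hxy⟩

/-- The contraction of `y` into `x`; the vertex `y` becomes isolated. -/
def contractInto (G : SimpleGraph V) (x y : V) : SimpleGraph V where
  Adj a b := a ≠ b ∧ a ≠ y ∧ b ≠ y ∧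
    (G.Adj a b ∨ (a = x ∧ G.Adj y b) ∨ (b = x ∧ G.Adj y a))
  symm := by
    constructor
    rintro a b ⟨h1, h2, h3, h4⟩
    refine ⟨h1.symm, h3, h2, ?_⟩
    rcases h4 with h | h | h
    · exact Or.inl h.symm
    · exact Or.inr (Or.inr h)
    · exact Or.inr (Or.inl h)
  loopless := ⟨fun a h => h.1 rfl⟩

theorem hasK6_of_contractInto {x y : V} (hxy : G.Adj x y) (h : HasK6 (contractInto G x y)) :
    HasK6 G := by
  obtain ⟨B, hc, hd, ha⟩ := h.exists_sets
  have hy : ∀ i, y ∉ B i := by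
    intro i hi
    obtain ⟨j, hj⟩ : ∃ j, i ≠ j := ⟨i + 1, by clear hi; revert i; decide⟩
    obtain ⟨a, hai, b, -, hab⟩ := ha i j hj
    obtain ⟨w⟩ := (hc i).preconnected ⟨y, hi⟩ ⟨a, hai⟩
    cases w with
    | nil => exact hab.2.1 rfl
    | cons h _ => exact h.2.1 rfl
  let B' : Fin 6 → Set V := fun i => B i ∪ {w | w = y ∧ x ∈ B i}
  have hsub : ∀ i, B i ⊆ B' i := fun i => Set.subset_union_left
  have key : ∀ i (u w : B i), (contractInto G x y |>.induce (B i)).Reachable u w →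
      (G.induce (B' i)).Reachable ⟨u, hsub i u.2⟩ ⟨w, hsub i w.2⟩ := by
    rintro i u w ⟨p⟩
    induction p with
    | nil => exact Reachable.refl _
    | @cons a b c hab _ ih =>
      refine Reachable.trans ?_ ih
      obtain ⟨-, -, -, hab⟩ := hab
      rcases hab with hab | ⟨hax, hyb⟩ | ⟨hbx, hya⟩
      · exact Adj.reachable (by exact hab)
      · have hyB : y ∈ B' i := Or.inr ⟨rfl, by rw [← hax]; exact a.2⟩
        have h1 : (G.induce (B' i)).Adj ⟨a, hsub i a.2⟩ ⟨y, hyB⟩ := by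
          show G.Adj a.1 y
          have : a.1 = x := hax
          rw [this]; exact hxy
        have h2 : (G.induce (B' i)).Adj ⟨y, hyB⟩ ⟨b, hsub i b.2⟩ := hyb
        exact h1.reachable.trans h2.reachable
      · have hyB : y ∈ B' i := Or.inr ⟨rfl, by rw [← hbx]; exact b.2⟩
        have h1 : (G.induce (B' i)).Adj ⟨y, hyB⟩ ⟨b, hsub i b.2⟩ := by
          show G.Adj y b.1
          have : b.1 = x := hbx
          rw [this]; exact hxy.symm
        have h2 : (G.induce (B' i)).Adj ⟨a, hsub i a.2⟩ ⟨y, hyB⟩ := (show G.Adj y a.1 from hya).symm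
        exact h2.reachable.trans h1.reachable
  refine hasK6_of_sets B' (fun i => ?_) (fun i j hij => ?_) (fun i j hij => ?_)
  · obtain ⟨b⟩ := (hc i).nonempty
    rw [connected_iff_exists_forall_reachable]
    refine ⟨⟨b, hsub i b.2⟩, ?_⟩
    rintro ⟨w, hw⟩
    rcases hw with hw | ⟨rfl, hx⟩
    · exact key i b ⟨w, hw⟩ ((hc i).preconnected _ _)
    · refine (key i b ⟨x, hx⟩ ((hc i).preconnected _ _)).trans (Adj.reachable ?_)
      exact hxy
  · rw [Set.disjoint_left]
    have hij' := Set.disjoint_left.1 (hd i j hij.ne)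
    rintro w (hw | ⟨rfl, hw⟩) (hw' | ⟨hwy, hw'⟩)
    · exact hij' hw hw'
    · exact hy i (hwy ▸ hw)
    · exact hy j hw'
    · exact hij' hw hw'
  · obtain ⟨a, hai, b, hbj, -, -, -, hab⟩ := ha i j hij.ne
    rcases hab with hab | ⟨rfl, hyb⟩ | ⟨rfl, hya⟩
    · exact ⟨a, hsub i hai, b, hsub j hbj, hab⟩
    · exact ⟨y, Or.inr ⟨rfl, hai⟩, b, hsub j hbj, hyb⟩
    · exact ⟨a, hsub i hai, y, Or.inr ⟨rfl, hbj⟩, hya.symm⟩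

theorem induce_singleton_connected (v : V) : (G.induce {v}).Connected := by
  have : Subsingleton ({v} : Set V) := inferInstance
  have : Nonempty ({v} : Set V) := ⟨⟨v, rfl⟩⟩
  exact ⟨Preconnected.of_subsingleton⟩

theorem hasK6_of_clique (f : Fin 6 → V) (h : ∀ i j, i < j → G.Adj (f i) (f j)) : HasK6 G := by
  refine hasK6_of_sets (fun i => {f i}) (fun i => induce_singleton_connected _)
    (fun i j hij => ?_) (fun i j hij => ⟨f i, rfl, f j, rfl, h i j hij⟩)
  simpa using (h i j hij).ne

/-- A `K₆` model with branch sets `{v}`, `P`, `Q`, `{x}`, `{y}`, `{z, t}`. -/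
theorem hasK6_of_model {v p q x y z t : V} {P Q : Set V}
    (hP : (G.induce P).Connected) (hQ : (G.induce Q).Connected)
    (hp : p ∈ P) (hq : q ∈ Q) (hvP : v ∉ P) (hvQ : v ∉ Q) (hPQ : Disjoint P Q)
    (hxP : x ∉ P) (hyP : y ∉ P) (hzP : z ∉ P) (htP : t ∉ P)
    (hxQ : x ∉ Q) (hyQ : y ∉ Q) (hzQ : z ∉ Q) (htQ : t ∉ Q)
    (hxz : x ≠ z) (hxt : x ≠ t) (hyz : y ≠ z) (hyt : y ≠ t) (hvt : v ≠ t)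
    (hvp : G.Adj v p) (hvq : G.Adj v q) (hvx : G.Adj v x) (hvy : G.Adj v y) (hvz : G.Adj v z)
    (hxy : G.Adj x y) (hzt : G.Adj z t)
    (hx : G.Adj x z ∨ G.Adj x t) (hy : G.Adj y z ∨ G.Adj y t)
    (hPQ' : ∃ a ∈ P, ∃ b ∈ Q, G.Adj a b)
    (hPx : ∃ a ∈ P, G.Adj a x) (hPy : ∃ a ∈ P, G.Adj a y) (hPz : ∃ a ∈ P, G.Adj a z ∨ G.Adj a t)
    (hQx : ∃ a ∈ Q, G.Adj a x) (hQy : ∃ a ∈ Q, G.Adj a y)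
    (hQz : ∃ a ∈ Q, G.Adj a z ∨ G.Adj a t) : HasK6 G := by
  have hvxne := hvx.ne
  have hvyne := hvy.ne
  have hvzne := hvz.ne
  have hxyne := hxy.ne
  refine hasK6_of_sets ![{v}, P, Q, {x}, {y}, {z, t}] ?_ ?_ ?_
  · intro i
    fin_cases i
    · exact induce_singleton_connected _
    · exact hP
    · exact hQ
    · exact induce_singleton_connected _
    · exact induce_singleton_connected _
    · exact induce_pair_connected_of_adj hzt
  · intro i j hij
    fin_cases i <;> fin_cases j <;> first | exact absurd hij (by decide) | skip
    all_goals simp_all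
  · obtain ⟨pq, hpq, hpq'⟩ := hPQ'
    obtain ⟨px, hpx, hpx'⟩ := hPx
    obtain ⟨py, hpy, hpy'⟩ := hPy
    obtain ⟨pz, hpz, hpz'⟩ := hPz
    obtain ⟨qx, hqx, hqx'⟩ := hQx
    obtain ⟨qy, hqy, hqy'⟩ := hQy
    obtain ⟨qz, hqz, hqz'⟩ := hQz
    intro i j hij
    fin_cases i <;> fin_cases j <;> first | exact absurd hij (by decide) | skip
    · exact ⟨v, rfl, p, hp, hvp⟩
    · exact ⟨v, rfl, q, hq, hvq⟩
    · exact ⟨v, rfl, x, rfl, hvx⟩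
    · exact ⟨v, rfl, y, rfl, hvy⟩
    · exact ⟨v, rfl, z, by simp, hvz⟩
    · exact ⟨pq, hpq, hpq'⟩
    · exact ⟨px, hpx, x, rfl, hpx'⟩
    · exact ⟨py, hpy, y, rfl, hpy'⟩
    · rcases hpz' with h | h
      · exact ⟨pz, hpz, z, by simp, h⟩
      · exact ⟨pz, hpz, t, by simp, h⟩
    · exact ⟨qx, hqx, x, rfl, hqx'⟩
    · exact ⟨qy, hqy, y, rfl, hqy'⟩
    · rcases hqz' with h | h
      · exact ⟨qz, hqz, z, by simp, h⟩
      · exact ⟨qz, hqz, t, by simp, h⟩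
    · exact ⟨x, rfl, y, rfl, hxy⟩
    · rcases hx with h | h
      · exact ⟨x, rfl, z, by simp, h⟩
      · exact ⟨x, rfl, t, by simp, h⟩
    · rcases hy with h | h
      · exact ⟨y, rfl, z, by simp, h⟩
      · exact ⟨y, rfl, t, by simp, h⟩

/-- Adding a vertex with a neighbour in a connected set keeps it connected. -/
theorem induce_insert_connected {C : Set V} {a c : V} (hC : (G.induce C).Connected) (hc : c ∈ C)
    (hac : G.Adj a c) : (G.induce (insert a C)).Connected := by
  rw [connected_iff_exists_forall_reachable]
  refine ⟨⟨c, Or.inr hc⟩, ?_⟩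
  rintro ⟨w, rfl | hw⟩
  · exact Adj.reachable (by exact hac.symm)
  · have := (hC.preconnected ⟨c, hc⟩ ⟨w, hw⟩).map
      (⟨fun u => ⟨u.1, Or.inr u.2⟩, fun h => h⟩ : G.induce C →g G.induce (insert a C))
    exact this

end Minors

section Counting

variable {V : Type} {G : SimpleGraph V}

/-- The number of edges. -/
noncomputable def ecard {V : Type} (G : SimpleGraph V) : ℕ := G.edgeSet.ncard

theorem ecard_eq [Fintype G.edgeSet] : ecard G = G.edgeFinset.card := by
  rw [ecard, Set.ncard_eq_toFinset_card']; rfl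

theorem vdeg_eq (v : V) [Fintype (G.neighborSet v)] : vdeg G v = G.degree v := by
  rw [vdeg, Set.ncard_eq_toFinset_card']; rfl

/-- The edges of `G` with both ends in `T`. -/
def within (G : SimpleGraph V) (T : Finset V) : SimpleGraph V where
  Adj a b := G.Adj a b ∧ a ∈ T ∧ b ∈ T
  symm := ⟨fun _ _ h => ⟨h.1.symm, h.2.2, h.2.1⟩⟩
  loopless := ⟨fun _ h => h.1.ne rfl⟩

theorem within_le (T : Finset V) : within G T ≤ G := fun _ _ h => h.1

theorem exists_subgraph_ecard_eq {k : ℕ} (hk : k ≤ ecard G) : ∃ G' ≤ G, ecard G' = k := by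
  obtain ⟨F, hF, hFk⟩ := Set.exists_subset_card_eq hk
  refine ⟨fromEdgeSet F, ?_, ?_⟩
  · intro a b hab
    exact hF ((fromEdgeSet_adj F).1 hab).1
  · have : (fromEdgeSet F).edgeSet = F := by
      rw [edgeSet_fromEdgeSet]
      refine sdiff_eq_left.2 (Set.disjoint_left.2 fun e he hd => ?_)
      exact G.not_isDiag_of_mem_edgeSet (hF he) hd
    rw [ecard, this, hFk]

/-- A connected set maximal inside `D`. -/
theorem exists_component {D : Finset V} {d : V} (hd : d ∈ D) : ∃ C ⊆ D, C.Nonempty ∧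
    (G.induce (C : Set V)).Connected ∧ ∀ c ∈ C, ∀ w ∈ D, G.Adj c w → w ∈ C := by
  classical
  obtain ⟨C, hC, hmax⟩ := Finset.exists_max_image
    (D.powerset.filter fun C : Finset V => (G.induce (C : Set V)).Connected) Finset.card
    ⟨{d}, Finset.mem_filter.2 ⟨by simpa using hd, by
      rw [Finset.coe_singleton]; exact induce_singleton_connected d⟩⟩
  simp only [Finset.mem_filter, Finset.mem_powerset] at hC hmax
  refine ⟨C, hC.1, ?_, hC.2, fun c hc w hw hcw => ?_⟩
  · obtain ⟨⟨x, hx⟩⟩ := hC.2.nonempty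
    exact ⟨x, hx⟩
  · by_contra hwC
    have := hmax (insert w C) ⟨Finset.insert_subset hw hC.1, by
      rw [Finset.coe_insert]; exact induce_insert_connected hC.2 hc hcw.symm⟩
    rw [Finset.card_insert_of_notMem hwC] at this
    omega

variable [Fintype V]

theorem sum_vdeg : ∑ v, vdeg G v = 2 * ecard G := by
  classical
  simp_rw [vdeg_eq, ecard_eq]
  exact G.sum_degrees_eq_twice_card_edges

/-- The set of common neighbours of two vertices, as a finset. -/
noncomputable def common (G : SimpleGraph V) (x y : V) : Finset V := by
  classical exact Finset.univ.filter fun w => G.Adj x w ∧ G.Adj y w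

theorem mem_common {x y w : V} : w ∈ common G x y ↔ G.Adj x w ∧ G.Adj y w := by
  classical simp [common]

theorem ecard_le_contractInto {x y : V} (hxy : G.Adj x y) :
    ecard G ≤ ecard (contractInto G x y) + 1 + (common G x y).card := by
  classical
  rw [ecard_eq, ecard_eq]
  set W := G.neighborFinset y \ (insert x (common G x y)) with hW
  have h1 : (G.edgeFinset \ G.incidenceFinset y) ∪ W.image (fun w => s(x, w)) ⊆
      (contractInto G x y).edgeFinset := by
    intro e he
    rw [mem_edgeFinset]
    rcases Finset.mem_union.1 he with he | he
    · obtain ⟨he1, he2⟩ := Finset.mem_sdiff.1 he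
      rw [mem_edgeFinset] at he1
      induction e with
      | _ a b =>
        have hab : G.Adj a b := he1
        have hy : y ≠ a ∧ y ≠ b := by
          simpa [mem_incidenceFinset, incidenceSet, hab] using he2
        exact ⟨hab.ne, hy.1.symm, hy.2.symm, Or.inl hab⟩
    · obtain ⟨w, hw, rfl⟩ := Finset.mem_image.1 he
      have hw' : G.Adj y w ∧ w ≠ x := by
        simp [hW] at hw; tauto
      exact ⟨hw'.2.symm, hxy.ne, hw'.1.ne', Or.inr (Or.inl ⟨rfl, hw'.1⟩)⟩
  have h2 : Disjoint (G.edgeFinset \ G.incidenceFinset y) (W.image (fun w => s(x, w))) := by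
    rw [Finset.disjoint_left]
    intro e he he'
    obtain ⟨w, hw, rfl⟩ := Finset.mem_image.1 he'
    have hxw : G.Adj x w := by
      have := (Finset.mem_sdiff.1 he).1
      rw [mem_edgeFinset] at this
      exact this
    simp [hW, mem_common, hxw] at hw
    tauto
  have h3 : (W.image (fun w => s(x, w))).card = W.card :=
    Finset.card_image_of_injective _ fun a b hab => Sym2.congr_right.1 hab
  have h4 := Finset.card_le_card h1
  rw [Finset.card_union_of_disjoint h2, h3] at h4
  have h5 : G.edgeFinset.card ≤ (G.edgeFinset \ G.incidenceFinset y).card + G.degree y := by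
    rw [← card_incidenceFinset_eq_degree]
    exact Finset.card_le_card_sdiff_add_card
  have h6 : G.degree y ≤ W.card + ((common G x y).card + 1) := by
    rw [← card_neighborFinset_eq_degree]
    refine Finset.card_le_card_sdiff_add_card.trans (Nat.add_le_add_left ?_ _)
    exact Finset.card_insert_le _ _
  omega

/-- Counting edges across a clique separation. -/
theorem ecard_add_choose_le {A B K : Finset V} (hKA : K ⊆ A) (hKB : K ⊆ B)
    (hcover : ∀ a b, G.Adj a b → a ∈ A ∧ b ∈ A ∨ a ∈ B ∧ b ∈ B)
    (hK : ∀ a ∈ K, ∀ b ∈ K, a ≠ b → G.Adj a b) :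
    ecard G + K.card.choose 2 ≤ ecard (within G A) + ecard (within G B) := by
  classical
  simp_rw [ecard_eq]
  rw [← Finset.card_union_add_card_inter, ← Sym2.card_image_offDiag]
  refine Nat.add_le_add (Finset.card_le_card ?_) (Finset.card_le_card ?_)
  · intro e he
    rw [Finset.mem_union, mem_edgeFinset, mem_edgeFinset]
    rw [mem_edgeFinset] at he
    induction e with
    | _ a b =>
      have hab : G.Adj a b := he
      rcases hcover a b hab with h | h
      · exact Or.inl ⟨hab, h⟩
      · exact Or.inr ⟨hab, h⟩
  · intro e he
    obtain ⟨⟨a, b⟩, hab, rfl⟩ := Finset.mem_image.1 he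
    obtain ⟨ha, hb, hne⟩ := Finset.mem_offDiag.1 hab
    rw [Finset.mem_inter, mem_edgeFinset, mem_edgeFinset]
    have := hK a ha b hb hne
    exact ⟨⟨this, hKA ha, hKA hb⟩, ⟨this, hKB ha, hKB hb⟩⟩

theorem ecard_le_delete (v : V) [DecidableEq V] :
    ecard G ≤ ecard (within G (Finset.univ.erase v)) + vdeg G v := by
  classical
  rw [vdeg_eq, ecard_eq, ecard_eq, ← card_incidenceFinset_eq_degree]
  refine (Finset.card_le_card_sdiff_add_card (t := G.incidenceFinset v)).trans
    (Nat.add_le_add_right (Finset.card_le_card ?_) _)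
  intro e he
  obtain ⟨he1, he2⟩ := Finset.mem_sdiff.1 he
  rw [mem_edgeFinset] at he1 ⊢
  induction e with
  | _ a b =>
    have hab : G.Adj a b := he1
    have hy : v ≠ a ∧ v ≠ b := by
      simpa [mem_incidenceFinset, incidenceSet, hab] using he2
    exact ⟨hab, by simp [hy.1.symm], by simp [hy.2.symm]⟩

end Counting

section Mader

variable {V : Type} [Fintype V] {G : SimpleGraph V}

/-- If `a` is a neighbour of `v` and misses `b` among the neighbours of `v`, then the common
neighbours of `v` and `a` avoid `a` and `b`. -/
theorem common_card_add_two_le {v a b c : V} (ha : G.Adj v a) (hb : G.Adj v b) (hc : G.Adj v c)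
    (hab : a ≠ b) (hac : a ≠ c) (hbc : b ≠ c) (hnb : ¬ G.Adj a b) (hnc : ¬ G.Adj a c) :
    (common G v a).card + 3 ≤ vdeg G v := by
  classical
  rw [vdeg_eq, ← card_neighborFinset_eq_degree]
  have h3 : ({a, b, c} : Finset V).card = 3 := Finset.card_eq_three.2 ⟨a, b, c, hab, hac, hbc, rfl⟩
  rw [← h3, ← Finset.card_union_of_disjoint]
  · refine Finset.card_le_card fun w hw => ?_
    rw [mem_neighborFinset]
    simp only [Finset.mem_union, mem_common, Finset.mem_insert, Finset.mem_singleton] at hw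
    rcases hw with hw | rfl | rfl | rfl
    exacts [hw.1, ha, hb, hc]
  · rw [Finset.disjoint_left]
    intro w hw hw'
    rw [mem_common] at hw
    simp only [Finset.mem_insert, Finset.mem_singleton] at hw'
    rcases hw' with rfl | rfl | rfl
    exacts [hw.2.ne rfl, hnb hw.2, hnc hw.2]

theorem common_card_add_one_le {v a b : V} (ha : G.Adj v a) (hb : G.Adj v b)
    (hab : a ≠ b) (hnb : ¬ G.Adj a b) : (common G v a).card + 2 ≤ vdeg G v := by
  classical
  rw [vdeg_eq, ← card_neighborFinset_eq_degree]
  have h3 : ({a, b} : Finset V).card = 2 := Finset.card_pair hab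
  rw [← h3, ← Finset.card_union_of_disjoint]
  · refine Finset.card_le_card fun w hw => ?_
    rw [mem_neighborFinset]
    simp only [Finset.mem_union, mem_common, Finset.mem_insert, Finset.mem_singleton] at hw
    rcases hw with hw | rfl | rfl
    exacts [hw.1, ha, hb]
  · rw [Finset.disjoint_left]
    intro w hw hw'
    rw [mem_common] at hw
    simp only [Finset.mem_insert, Finset.mem_singleton] at hw'
    rcases hw' with rfl | rfl
    exacts [hw.2.ne rfl, hnb hw.2]

theorem exists_four_of_card {α : Type} {s : Finset α} (h : s.card = 4) :
    ∃ b : Fin 4 → α, Function.Injective b ∧ ∀ i, b i ∈ s :=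
  ⟨fun i => (s.equivFin.symm (Fin.cast h.symm i)).1, fun i j hij => by
    simpa using Subtype.ext hij, fun i => (s.equivFin.symm (Fin.cast h.symm i)).2⟩

/-- The case of two nonadjacent neighbours `a`, `a'` of a vertex `v` of degree six, both attached to
a connected set `C` avoiding `v` and its neighbourhood. -/
theorem hasK6_of_attached_pair {v a a' : V} {C : Set V} (hdeg : vdeg G v = 6)
    (hcom : ∀ u, G.Adj v u → 4 ≤ (common G v u).card) (hC : (G.induce C).Connected)
    (hvC : v ∉ C) (hNC : ∀ u, G.Adj v u → u ∉ C) (ha : G.Adj v a) (ha' : G.Adj v a')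
    (hne : a ≠ a') (hnadj : ¬ G.Adj a a') (hCa : ∃ c ∈ C, G.Adj c a) (hCa' : ∃ c ∈ C, G.Adj c a') :
    HasK6 G := by
  classical
  have miss : ∀ u p q, G.Adj v u → G.Adj v p → G.Adj v q → u ≠ p → u ≠ q → p ≠ q →
      G.Adj u p ∨ G.Adj u q := by
    intro u p q hu hp hq hup huq hpq
    by_contra! h
    have := common_card_add_two_le hu hp hq hup huq hpq h.1 h.2
    have := hcom u hu
    omega
  have hcard : ((G.neighborFinset v) \ {a, a'}).card = 4 := by
    rw [Finset.card_sdiff_of_subset, card_neighborFinset_eq_degree, ← vdeg_eq, hdeg,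
      Finset.card_pair hne]
    intro w hw
    simp only [Finset.mem_insert, Finset.mem_singleton] at hw
    rw [mem_neighborFinset]
    rcases hw with rfl | rfl
    exacts [ha, ha']
  obtain ⟨b, hinj, hb⟩ := exists_four_of_card hcard
  simp only [Finset.mem_sdiff, mem_neighborFinset, Finset.mem_insert, Finset.mem_singleton,
    not_or] at hb
  have hbb : ∀ i j, i ≠ j → b i ≠ b j := fun i j hij h => hij (hinj h)
  have hab : ∀ i, G.Adj a (b i) := fun i =>
    (miss a a' (b i) ha ha' (hb i).1 hne (Ne.symm (hb i).2.1) (Ne.symm (hb i).2.2)).resolve_left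
      hnadj
  have hab' : ∀ i, G.Adj a' (b i) := fun i =>
    (miss a' a (b i) ha' ha (hb i).1 hne.symm (Ne.symm (hb i).2.2)
      (Ne.symm (hb i).2.1)).resolve_left fun h => hnadj h.symm
  obtain ⟨c, hc, hca⟩ := hCa
  obtain ⟨c', hc', hca'⟩ := hCa'
  have model : ∀ i j k l : Fin 4, i ≠ j → i ≠ k → i ≠ l → j ≠ k → j ≠ l → k ≠ l →
      G.Adj (b i) (b j) → G.Adj (b k) (b l) → (G.Adj (b i) (b k) ∨ G.Adj (b i) (b l)) →
      (G.Adj (b j) (b k) ∨ G.Adj (b j) (b l)) → HasK6 G := by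
    intro i j k l hij hik hil hjk hjl hkl h1 h2 h3 h4
    have hbP : ∀ i, b i ∉ insert a C := by
      rintro i (h | h)
      · exact (hb i).2.1 h
      · exact hNC _ (hb i).1 h
    have hbQ : ∀ i, b i ∉ ({a'} : Set V) := fun i h => (hb i).2.2 h
    refine hasK6_of_model (v := v) (p := a) (q := a') (x := b i) (y := b j) (z := b k) (t := b l)
      (P := insert a C) (Q := {a'}) (induce_insert_connected hC hc hca.symm)
      (induce_singleton_connected _) (Set.mem_insert _ _) rfl ?_ ha'.ne ?_
      (hbP i) (hbP j) (hbP k) (hbP l) (hbQ i) (hbQ j) (hbQ k) (hbQ l)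
      (hbb _ _ hik) (hbb _ _ hil) (hbb _ _ hjk) (hbb _ _ hjl) (hb l).1.ne ha ha'
      (hb i).1 (hb j).1 (hb k).1 h1 h2 h3 h4 ⟨c', Or.inr hc', a', rfl, hca'⟩
      ⟨a, Or.inl rfl, hab i⟩ ⟨a, Or.inl rfl, hab j⟩ ⟨a, Or.inl rfl, Or.inl (hab k)⟩
      ⟨a', rfl, hab' i⟩ ⟨a', rfl, hab' j⟩ ⟨a', rfl, Or.inl (hab' k)⟩
    · rintro (h | h)
      · exact ha.ne h
      · exact hvC h
    · rw [Set.disjoint_singleton_right]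
      rintro (h | h)
      · exact hne h.symm
      · exact hNC a' ha' h
  have missb : ∀ i j k, i ≠ j → i ≠ k → j ≠ k → G.Adj (b i) (b j) ∨ G.Adj (b i) (b k) :=
    fun i j k hij hik hjk => miss _ _ _ (hb i).1 (hb j).1 (hb k).1 (hbb _ _ hij) (hbb _ _ hik)
      (hbb _ _ hjk)
  by_cases h1 : G.Adj (b 0) (b 1)
  · by_cases h2 : G.Adj (b 2) (b 3)
    · exact model 0 1 2 3 (by decide) (by decide) (by decide) (by decide) (by decide) (by decide)
        h1 h2 (missb 0 2 3 (by decide) (by decide) (by decide))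
        (missb 1 2 3 (by decide) (by decide) (by decide))
    · have h2' : ¬ G.Adj (b 3) (b 2) := fun h => h2 h.symm
      have e20 := (missb 2 3 0 (by decide) (by decide) (by decide)).resolve_left h2
      have e21 := (missb 2 3 1 (by decide) (by decide) (by decide)).resolve_left h2
      have e31 := (missb 3 2 1 (by decide) (by decide) (by decide)).resolve_left h2'
      exact model 0 2 1 3 (by decide) (by decide) (by decide) (by decide) (by decide) (by decide)
        e20.symm e31.symm (Or.inl h1) (Or.inl e21)
  · have h1' : ¬ G.Adj (b 1) (b 0) := fun h => h1 h.symm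
    have e02 := (missb 0 1 2 (by decide) (by decide) (by decide)).resolve_left h1
    have e03 := (missb 0 1 3 (by decide) (by decide) (by decide)).resolve_left h1
    have e12 := (missb 1 0 2 (by decide) (by decide) (by decide)).resolve_left h1'
    have e13 := (missb 1 0 3 (by decide) (by decide) (by decide)).resolve_left h1'
    exact model 0 2 1 3 (by decide) (by decide) (by decide) (by decide) (by decide) (by decide)
      e02 e13 (Or.inr e03) (Or.inl e12.symm)

/-- **Mader's bound** for at most twelve vertices: `4n - 9` edges force a `K₆` minor. -/
theorem hasK6_of_ecard (n : ℕ) (h5 : 5 ≤ n) (h12 : n ≤ 12) (S : Finset V) (G : SimpleGraph V)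
    (hS : S.card = n) (hsupp : ∀ a b, G.Adj a b → a ∈ S) (he : 4 * n ≤ ecard G + 9) :
    HasK6 G := by
  classical
  induction n using Nat.strong_induction_on generalizing S G with
  | _ n ih =>
  -- pass to a subgraph with exactly `4 n - 9` edges
  obtain ⟨G', hle, hG'⟩ := exists_subgraph_ecard_eq (G := G) (k := 4 * n - 9) (by omega)
  refine HasK6.mono hle ?_
  have hsupp' : ∀ a b, G'.Adj a b → a ∈ S := fun a b h => hsupp a b (hle h)
  clear hsupp he hle
  generalize G' = G at *
  have he : ecard G + 9 = 4 * n := by omega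
  clear hG'
  have hsum : ∑ v ∈ S, vdeg G v = 2 * ecard G := by
    rw [← sum_vdeg]
    refine Finset.sum_subset (Finset.subset_univ _) fun v _ hv => ?_
    rw [vdeg, Set.ncard_eq_zero]
    ext w
    simpa using fun h => hv (hsupp' v w h)
  have hvdeg_lt : ∀ v ∈ S, vdeg G v + 1 ≤ n := by
    intro v hv
    rw [vdeg_eq, ← card_neighborFinset_eq_degree, ← hS,
      ← Finset.card_erase_add_one hv]
    refine Nat.add_le_add_right (Finset.card_le_card fun w hw => ?_) 1
    rw [mem_neighborFinset] at hw
    exact Finset.mem_erase.2 ⟨hw.ne', hsupp' w v hw.symm⟩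
  have hn6 : 6 ≤ n := by
    by_contra h
    have hn : n = 5 := by omega
    have : ∑ v ∈ S, vdeg G v ≤ ∑ v ∈ S, 4 := Finset.sum_le_sum fun v hv => by
      have := hvdeg_lt v hv; omega
    rw [Finset.sum_const, hS, smul_eq_mul] at this
    omega
  by_contra hK
  have hdel : ∀ v ∈ S, 5 ≤ vdeg G v := by
    intro v hv
    by_contra hlt
    have h1 := ecard_le_delete (G := G) v
    refine hK (HasK6.mono (within_le _) (ih (n - 1) (by omega) (by omega) (by omega) (S.erase v)
      (within G (Finset.univ.erase v)) (by rw [Finset.card_erase_of_mem hv, hS]) ?_ (by omega)))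
    intro a b hab
    exact Finset.mem_erase.2 ⟨Finset.ne_of_mem_erase hab.2.1, hsupp' a b hab.1⟩
  have hcom : ∀ x y, G.Adj x y → 4 ≤ (common G x y).card := by
    intro x y hxy
    by_contra hlt
    have h1 := ecard_le_contractInto hxy
    have hy : y ∈ S := hsupp' y x hxy.symm
    refine hK (hasK6_of_contractInto hxy (ih (n - 1) (by omega) (by omega) (by omega) (S.erase y)
      _ (by rw [Finset.card_erase_of_mem hy, hS]) ?_ (by omega)))
    rintro a b ⟨-, hay, -, hab⟩
    refine Finset.mem_erase.2 ⟨hay, ?_⟩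
    rcases hab with h | ⟨rfl, -⟩ | ⟨-, h⟩
    exacts [hsupp' _ _ h, hsupp' _ _ hxy, hsupp' _ _ h.symm]
  have hdeg6 : ∀ v ∈ S, 6 ≤ vdeg G v := by
    intro v hv
    by_contra hlt
    have h5 : vdeg G v = 5 := by have := hdel v hv; omega
    have hadj : ∀ a b, G.Adj v a → G.Adj v b → a ≠ b → G.Adj a b := by
      intro a b ha hb hab
      by_contra hnb
      have := common_card_add_one_le ha hb hab hnb
      have := hcom v a ha
      omega
    have hcard : (insert v (G.neighborFinset v)).card = 6 := by
      rw [Finset.card_insert_of_notMem (by simp), card_neighborFinset_eq_degree, ← vdeg_eq, h5]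
    refine hK (hasK6_of_clique
      (fun i => ((insert v (G.neighborFinset v)).equivFin.symm (Fin.cast hcard.symm i)).1) ?_)
    intro i j hij
    set x := (insert v (G.neighborFinset v)).equivFin.symm (Fin.cast hcard.symm i) with hx
    set y := (insert v (G.neighborFinset v)).equivFin.symm (Fin.cast hcard.symm j) with hy
    have hxy : x.1 ≠ y.1 := by
      intro h
      have : i = j := by simpa [hx, hy] using Subtype.ext h
      exact hij.ne this
    have hx2 := x.2
    have hy2 := y.2
    rw [Finset.mem_insert, mem_neighborFinset] at hx2 hy2
    rcases hx2 with hx2 | hx2 <;> rcases hy2 with hy2 | hy2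
    · exact absurd (hx2.trans hy2.symm) hxy
    · rw [hx2]; exact hy2
    · rw [hy2]; exact hx2.symm
    · exact hadj _ _ hx2 hy2 hxy
  have hn9 : 9 ≤ n := by
    have : ∑ v ∈ S, 6 ≤ ∑ v ∈ S, vdeg G v := Finset.sum_le_sum hdeg6
    rw [Finset.sum_const, hS, smul_eq_mul] at this
    omega
  obtain ⟨v, hv, hv6⟩ : ∃ v ∈ S, vdeg G v = 6 := by
    by_contra! h
    have : ∑ v ∈ S, 7 ≤ ∑ v ∈ S, vdeg G v := Finset.sum_le_sum fun v hv => by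
      have := h v hv; have := hdeg6 v hv; omega
    rw [Finset.sum_const, hS, smul_eq_mul] at this
    omega
  set D := S \ insert v (G.neighborFinset v) with hD
  have hNS : insert v (G.neighborFinset v) ⊆ S := by
    refine Finset.insert_subset hv fun w hw => ?_
    rw [mem_neighborFinset] at hw
    exact hsupp' w v hw.symm
  have hcardN : (insert v (G.neighborFinset v)).card = 7 := by
    rw [Finset.card_insert_of_notMem (by simp), card_neighborFinset_eq_degree, ← vdeg_eq, hv6]
  obtain ⟨d, hd⟩ : D.Nonempty := by
    rw [← Finset.card_pos, hD, Finset.card_sdiff_of_subset hNS, hS, hcardN]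
    omega
  obtain ⟨C, hCD, hCne, hCconn, hCmax⟩ := exists_component (G := G) hd
  have hmemD : ∀ w, w ∈ D ↔ w ∈ S ∧ w ≠ v ∧ ¬ G.Adj v w := by
    intro w
    simp [hD]
  set K := (G.neighborFinset v).filter (fun a => ∃ c ∈ C, G.Adj c a) with hKdef
  have hmemK : ∀ w, w ∈ K ↔ G.Adj v w ∧ ∃ c ∈ C, G.Adj c w := by
    intro w; simp [hKdef]
  have hclique : ∀ a ∈ K, ∀ b ∈ K, a ≠ b → G.Adj a b := by
    intro a ha b hb hab
    by_contra hnadj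
    rw [hmemK] at ha hb
    refine hK (hasK6_of_attached_pair (C := (C : Set V)) hv6 (hcom v) hCconn ?_ ?_ ha.1 hb.1 hab
      hnadj ha.2 hb.2)
    · exact fun h => ((hmemD _).1 (hCD h)).2.1 rfl
    · exact fun u hu h => ((hmemD _).1 (hCD h)).2.2 hu
  have hnbr : ∀ c ∈ C, ∀ w, G.Adj c w → w ∈ C ∪ K := by
    intro c hc w hcw
    have hcD := (hmemD c).1 (hCD hc)
    rw [Finset.mem_union]
    by_cases hw : G.Adj v w
    · exact Or.inr ((hmemK w).2 ⟨hw, c, hc, hcw⟩)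
    · refine Or.inl (hCmax c hc w ((hmemD w).2 ⟨hsupp' w c hcw.symm, ?_, hw⟩) hcw)
      rintro rfl
      exact hcD.2.2 hcw.symm
  have hCS : C ⊆ S := fun c hc => ((hmemD c).1 (hCD hc)).1
  have hKS : K ⊆ S := fun a ha => hsupp' a v ((hmemK a).1 ha).1.symm
  have hCK : Disjoint C K := Finset.disjoint_left.2 fun c hc hcK =>
    ((hmemD c).1 (hCD hc)).2.2 ((hmemK c).1 hcK).1
  have hcount := ecard_add_choose_le (G := G) (A := C ∪ K) (B := S \ C) (K := K)
    Finset.subset_union_right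
    (fun a ha => Finset.mem_sdiff.2 ⟨hKS ha, fun h => Finset.disjoint_left.1 hCK h ha⟩)
    (by
      intro a b hab
      by_cases ha : a ∈ C
      · exact Or.inl ⟨Finset.mem_union_left _ ha, hnbr a ha b hab⟩
      · by_cases hb : b ∈ C
        · exact Or.inl ⟨hnbr b hb a hab.symm, Finset.mem_union_left _ hb⟩
        · exact Or.inr ⟨Finset.mem_sdiff.2 ⟨hsupp' _ _ hab, ha⟩,
            Finset.mem_sdiff.2 ⟨hsupp' _ _ hab.symm, hb⟩⟩) hclique
  have hcard1 : (C ∪ K).card = C.card + K.card := Finset.card_union_of_disjoint hCK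
  have hcard2 : (S \ C).card = n - C.card := by rw [Finset.card_sdiff_of_subset hCS, hS]
  have hK6 : K.card ≤ 6 := by
    rw [← hv6, vdeg_eq, ← card_neighborFinset_eq_degree]
    exact Finset.card_filter_le _ _
  have hCpos := hCne.card_pos
  have hlow : 7 ≤ C.card + K.card := by
    obtain ⟨c, hc⟩ := hCne
    rw [← hcard1]
    have h1 := hdeg6 c (hCS hc)
    have h2 : insert c (G.neighborFinset c) ⊆ C ∪ K := by
      refine Finset.insert_subset (Finset.mem_union_left _ hc) fun w hw => ?_
      exact hnbr c hc w ((mem_neighborFinset _ _ _).1 hw)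
    have h3 := Finset.card_le_card h2
    rw [Finset.card_insert_of_notMem (by simp), card_neighborFinset_eq_degree, ← vdeg_eq] at h3
    omega
  have hCn : C.card + 7 ≤ n := by
    rw [← hcardN, ← hS, ← Finset.card_union_of_disjoint]
    · exact Finset.card_le_card (Finset.union_subset hCS hNS)
    · refine Finset.disjoint_left.2 fun c hc hc' => ?_
      have := Finset.mem_sdiff.1 (hCD hc)
      exact this.2 hc'
  have e1 : ecard (within G (C ∪ K)) + 9 < 4 * (C.card + K.card) := by
    by_contra! h
    exact hK (HasK6.mono (within_le _) (ih (C.card + K.card) (by omega) (by omega) (by omega)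
      (C ∪ K) _ hcard1 (fun a b h => h.2.1) h))
  have e2 : ecard (within G (S \ C)) + 9 < 4 * (n - C.card) := by
    by_contra! h
    exact hK (HasK6.mono (within_le _) (ih (n - C.card) (by omega) (by omega) (by omega)
      (S \ C) _ hcard2 (fun a b h => h.2.1) h))
  have : 11 + K.card.choose 2 ≤ 4 * K.card := by omega
  revert this
  generalize K.card = k at hK6
  interval_cases k <;> decide

end Mader

/-- The number of indices where `f` is true. -/
def cnt (f : Fin 6 → Bool) : ℕ := ∑ k, (f k).toNat

theorem exists_of_cnt_pos {f : Fin 6 → Bool} (h : 1 ≤ cnt f) : ∃ k, f k = true := by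
  by_contra! hf
  have : cnt f = 0 := Finset.sum_eq_zero fun k _ => by simp [hf k]
  omega

theorem exists_ne_of_cnt {f : Fin 6 → Bool} (h : 2 ≤ cnt f) (u : Fin 6) :
    ∃ k, k ≠ u ∧ f k = true := by
  by_contra! hf
  have : cnt f ≤ 1 := by
    rw [cnt, ← Finset.add_sum_erase _ _ (Finset.mem_univ u), Finset.sum_eq_zero]
    · exact Bool.toNat_le _
    · intro k hk
      simp [hf k (Finset.ne_of_mem_erase hk)]
  omega

theorem sum_cnt_comm (R : Fin 6 → Fin 6 → Bool) : ∑ j, cnt (R j) = ∑ i, cnt fun j => R j i :=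
  Finset.sum_comm

theorem cnt_mono {f g : Fin 6 → Bool} (h : ∀ k, f k = true → g k = true) : cnt f ≤ cnt g :=
  Finset.sum_le_sum fun k _ => by
    cases hf : f k
    · simp
    · simp [h k hf]

/-- A vertex `v` of degree six, together with enumerations `a` of its six neighbours and
`d` of the six remaining vertices. -/
structure Frame {V : Type} (G : SimpleGraph V) where
  v : V
  a : Fin 6 → V
  d : Fin 6 → V
  a_inj : Function.Injective a
  d_inj : Function.Injective d
  va : ∀ i, G.Adj v (a i)
  vd : ∀ j, ¬ G.Adj v (d j)
  v_ne_d : ∀ j, v ≠ d j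
  cover : ∀ w, w = v ∨ (∃ i, w = a i) ∨ ∃ j, w = d j

namespace Frame

variable {V : Type} {G : SimpleGraph V} (F : Frame G)

/-- Adjacency among the neighbours of `v`. -/
noncomputable def H (i k : Fin 6) : Bool := by
  classical exact decide (G.Adj (F.a i) (F.a k))

/-- Adjacency between the non-neighbours and the neighbours of `v`. -/
noncomputable def R (j i : Fin 6) : Bool := by
  classical exact decide (G.Adj (F.d j) (F.a i))

/-- Non-adjacency among the non-neighbours of `v`. -/
noncomputable def C (j k : Fin 6) : Bool := by
  classical exact decide (j ≠ k ∧ ¬ G.Adj (F.d j) (F.d k))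

theorem H_iff {i k : Fin 6} : F.H i k = true ↔ G.Adj (F.a i) (F.a k) := by simp [H]
theorem R_iff {j i : Fin 6} : F.R j i = true ↔ G.Adj (F.d j) (F.a i) := by simp [R]
theorem C_iff {j k : Fin 6} : F.C j k = true ↔ j ≠ k ∧ ¬ G.Adj (F.d j) (F.d k) := by simp [C]

theorem adj_of_C {j k : Fin 6} (hjk : j ≠ k) (h : F.C j k = false) : G.Adj (F.d j) (F.d k) := by
  by_contra h'
  have := F.C_iff.2 ⟨hjk, h'⟩
  simp [h] at this

theorem H_symm (i k : Fin 6) : F.H i k = F.H k i := by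
  rw [Bool.eq_iff_iff, H_iff, H_iff, G.adj_comm]
theorem H_self (i : Fin 6) : F.H i i = false := by
  rw [← Bool.not_eq_true, H_iff]; exact G.irrefl
theorem C_symm (i k : Fin 6) : F.C i k = F.C k i := by
  rw [Bool.eq_iff_iff, C_iff, C_iff, G.adj_comm, ne_comm]
theorem C_self (i : Fin 6) : F.C i i = false := by
  rw [← Bool.not_eq_true, C_iff]; simp

theorem a_ne_d (i j : Fin 6) : F.a i ≠ F.d j := fun h => F.vd j (h ▸ F.va i)

/-- Relabelling of the two parts of a frame. -/
def perm (σ τ : Equiv.Perm (Fin 6)) : Frame G where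
  v := F.v
  a := F.a ∘ σ
  d := F.d ∘ τ
  a_inj := F.a_inj.comp σ.injective
  d_inj := F.d_inj.comp τ.injective
  va i := F.va _
  vd j := F.vd _
  v_ne_d j := F.v_ne_d _
  cover w := by
    rcases F.cover w with h | ⟨i, h⟩ | ⟨j, h⟩
    · exact Or.inl h
    · exact Or.inr (Or.inl ⟨σ.symm i, by simp [h]⟩)
    · exact Or.inr (Or.inr ⟨τ.symm j, by simp [h]⟩)

theorem perm_H (σ τ : Equiv.Perm (Fin 6)) (i k : Fin 6) :
    (F.perm σ τ).H i k = F.H (σ i) (σ k) := by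
  rw [Bool.eq_iff_iff, H_iff, H_iff]; rfl

theorem cnt_not_C (j : Fin 6) :
    cnt (fun k => !F.C j k) + cnt (F.C j) = 6 := by
  rw [cnt, cnt, ← Finset.sum_add_distrib]
  have : ∀ k, (!F.C j k).toNat + (F.C j k).toNat = 1 := fun k => by cases F.C j k <;> rfl
  simp [this]

section Sums

variable [Fintype V]

theorem sum_eq (g : V → ℕ) : ∑ w, g w = g F.v + ∑ i, g (F.a i) + ∑ j, g (F.d j) := by
  classical
  have huniv : (Finset.univ : Finset V) =
      insert F.v (Finset.univ.image F.a ∪ Finset.univ.image F.d) := by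
    ext w
    have := F.cover w
    simp only [Finset.mem_univ, Finset.mem_insert, Finset.mem_union, Finset.mem_image, true_and,
      true_iff]
    rcases this with h | ⟨i, h⟩ | ⟨j, h⟩
    · exact Or.inl h
    · exact Or.inr (Or.inl ⟨i, h.symm⟩)
    · exact Or.inr (Or.inr ⟨j, h.symm⟩)
  rw [huniv, Finset.sum_insert, Finset.sum_union, Finset.sum_image F.a_inj.injOn,
    Finset.sum_image F.d_inj.injOn, add_assoc]
  · rw [Finset.disjoint_left]
    intro w hw hw'
    simp only [Finset.mem_image, Finset.mem_univ, true_and] at hw hw'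
    obtain ⟨i, rfl⟩ := hw
    obtain ⟨j, h⟩ := hw'
    exact F.a_ne_d i j h.symm
  · simp only [Finset.mem_union, Finset.mem_image, Finset.mem_univ, true_and, not_or, not_exists]
    exact ⟨fun i h => (F.va i).ne h.symm, fun j h => F.v_ne_d j h.symm⟩

theorem card_filter_eq (p : V → Prop) [DecidablePred p] :
    (Finset.univ.filter p).card = (decide (p F.v)).toNat + cnt (fun i => decide (p (F.a i))) +
      cnt (fun j => decide (p (F.d j))) := by
  have : ∀ w, (if p w then 1 else 0) = (decide (p w)).toNat := fun w => by
    by_cases h : p w <;> simp [h]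
  rw [Finset.card_filter, F.sum_eq]
  simp only [this, cnt]

theorem vdeg_a (i : Fin 6) : vdeg G (F.a i) = 1 + cnt (F.H i) + cnt (fun j => F.R j i) := by
  classical
  rw [vdeg_eq, ← card_neighborFinset_eq_degree, neighborFinset_eq_filter, F.card_filter_eq]
  have h1 : decide (G.Adj (F.a i) F.v) = true := by simpa using (F.va i).symm
  have h2 : (fun k => decide (G.Adj (F.a i) (F.a k))) = F.H i := by
    ext k; simp [H]
  have h3 : (fun j => decide (G.Adj (F.a i) (F.d j))) = fun j => F.R j i := by
    ext k; simp [R, G.adj_comm]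
  rw [h1, h2, h3]; rfl

theorem vdeg_d (j : Fin 6) : vdeg G (F.d j) + cnt (F.C j) = cnt (F.R j) + 5 := by
  classical
  rw [vdeg_eq, ← card_neighborFinset_eq_degree, neighborFinset_eq_filter, F.card_filter_eq]
  have h1 : decide (G.Adj (F.d j) F.v) = false := by
    simpa using fun h => F.vd j (G.symm.symm _ _ h)
  have h2 : (fun k => decide (G.Adj (F.d j) (F.a k))) = F.R j := by
    ext k; simp [R]
  have h3 : cnt (fun k => decide (G.Adj (F.d j) (F.d k))) + 1 = cnt (fun k => !F.C j k) := by
    rw [cnt, cnt, ← Finset.add_sum_erase _ _ (Finset.mem_univ j),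
      ← Finset.add_sum_erase (Finset.univ) (fun k => (!F.C j k).toNat) (Finset.mem_univ j)]
    have : ∀ k ∈ Finset.univ.erase j,
        (!F.C j k).toNat = (decide (G.Adj (F.d j) (F.d k))).toNat := by
      intro k hk
      have hkj := Finset.ne_of_mem_erase hk
      by_cases h : G.Adj (F.d j) (F.d k) <;> simp [C, h, hkj.symm]
    rw [Finset.sum_congr rfl this, F.C_self]
    simp
    omega
  have := F.cnt_not_C j
  rw [h1, h2]
  simp only [Bool.toNat_false]
  omega

theorem common_v (i : Fin 6) : (common G F.v (F.a i)).card = cnt (F.H i) := by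
  classical
  unfold common
  rw [F.card_filter_eq]
  have h2 : (fun k => decide (G.Adj F.v (F.a k) ∧ G.Adj (F.a i) (F.a k))) = F.H i := by
    ext k; simp [H, F.va k]
  rw [h2]
  simp [cnt, F.vd]

theorem common_d {j i : Fin 6} (hR : F.R j i = true) :
    (common G (F.d j) (F.a i)).card + 1 ≤
      cnt (fun k => F.R j k && F.H i k) + cnt (fun k => F.R k i) := by
  classical
  unfold common
  rw [F.card_filter_eq]
  have h1 : ¬ G.Adj (F.d j) F.v := fun h => F.vd j h.symm
  have h2 : (fun k => decide (G.Adj (F.d j) (F.a k) ∧ G.Adj (F.a i) (F.a k))) =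
      fun k => F.R j k && F.H i k := by
    ext k; simp [H, R]
  rw [h2]
  simp only [h1, false_and, decide_false, Bool.toNat_false, zero_add, add_assoc]
  refine Nat.add_le_add_left ?_ _
  rw [cnt, cnt, ← Finset.add_sum_erase _ _ (Finset.mem_univ j),
      ← Finset.add_sum_erase (Finset.univ) (fun k => (F.R k i).toNat) (Finset.mem_univ j), hR]
  have : ∑ k ∈ Finset.univ.erase j, (decide (G.Adj (F.d j) (F.d k) ∧ G.Adj (F.a i) (F.d k))).toNat
      ≤ ∑ k ∈ Finset.univ.erase j, (F.R k i).toNat := by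
    refine Finset.sum_le_sum fun k _ => ?_
    by_cases h : G.Adj (F.d k) (F.a i)
    · simp only [R, h, decide_true]
      exact Bool.toNat_le _
    · have h' : ¬ G.Adj (F.a i) (F.d k) := fun h' => h h'.symm
      simp [h']
  simp only [G.irrefl, false_and, decide_false, Bool.toNat_false, Bool.toNat_true]
  omega

end Sums

end Frame

/-- Every vertex of degree six of a graph on thirteen vertices gives a frame. -/
theorem exists_frame {V : Type} [Fintype V] {G : SimpleGraph V} (hV : Fintype.card V = 13) {v : V}
    (hv : vdeg G v = 6) : Nonempty (Frame G) := by
  classical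
  have h1 : (G.neighborFinset v).card = 6 := by
    rw [card_neighborFinset_eq_degree, ← vdeg_eq, hv]
  have h2 : (Finset.univ \ insert v (G.neighborFinset v)).card = 6 := by
    rw [Finset.card_sdiff_of_subset (Finset.subset_univ _),
      Finset.card_insert_of_notMem (by simp), h1, Finset.card_univ, hV]
  set D := Finset.univ \ insert v (G.neighborFinset v) with hD
  let e1 := (G.neighborFinset v).equivFinOfCardEq h1
  let e2 := D.equivFinOfCardEq h2
  have hd : ∀ w ∈ D, w ≠ v ∧ ¬ G.Adj v w := by
    intro w hw
    simpa [hD] using hw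
  refine ⟨⟨v, fun i => (e1.symm i).1, fun j => (e2.symm j).1, ?_, ?_, ?_, ?_, ?_, ?_⟩⟩
  · exact Subtype.val_injective.comp e1.symm.injective
  · exact Subtype.val_injective.comp e2.symm.injective
  · exact fun i => (mem_neighborFinset _ _ _).1 (e1.symm i).2
  · exact fun j => (hd _ (e2.symm j).2).2
  · exact fun j => (hd _ (e2.symm j).2).1.symm
  · intro w
    by_cases h : w = v
    · exact Or.inl h
    · by_cases h' : G.Adj v w
      · exact Or.inr (Or.inl ⟨e1 ⟨w, (mem_neighborFinset _ _ _).2 h'⟩, by simp⟩)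
      · exact Or.inr (Or.inr ⟨e2 ⟨w, by simp [hD, h, h']⟩, by simp⟩)

namespace Frame

variable {V : Type} {G : SimpleGraph V} (F : Frame G)

/-- The numerical constraints satisfied by a frame of a graph with 42 edges, minimum degree
six and no `K₆` minor. -/
structure Critical : Prop where
  noK6 : ¬ HasK6 G
  three_le_H : ∀ i, 3 ≤ cnt (F.H i)
  C_lt_R : ∀ j, cnt (F.C j) + 1 ≤ cnt (F.R j)
  five_le : ∀ i, 5 ≤ cnt (F.H i) + cnt fun j => F.R j i
  sum_C : ∑ j, cnt (F.C j) + 42 = 2 * ∑ j, cnt (F.R j) + ∑ i, cnt (F.H i)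
  triangles : ∀ j i, F.R j i = true →
    4 ≤ cnt (fun k => F.R j k && F.H i k) + cnt fun k => F.R k i

theorem critical [Fintype V] (hV : Fintype.card V = 13) (hdeg : ∀ v, 6 ≤ vdeg G v)
    (hE : ecard G = 42) (hK : ¬ HasK6 G) (F : Frame G) : F.Critical := by
  classical
  have hcom : ∀ x y, G.Adj x y → 3 ≤ (common G x y).card := by
    intro x y hxy
    by_contra hlt
    have h1 := ecard_le_contractInto hxy
    refine hK (hasK6_of_contractInto hxy (hasK6_of_ecard 12 (by omega) (by omega)
      (Finset.univ.erase y) _ ?_ ?_ (by omega)))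
    · rw [Finset.card_erase_of_mem (Finset.mem_univ _), Finset.card_univ, hV]
    · rintro a b ⟨-, hay, -⟩
      exact Finset.mem_erase.2 ⟨hay, Finset.mem_univ _⟩
  have hva := F.vdeg_a
  have hvd := F.vdeg_d
  have hvv : vdeg G F.v = 6 := by
    rw [vdeg_eq, ← card_neighborFinset_eq_degree, neighborFinset_eq_filter, F.card_filter_eq]
    simp [cnt, F.va, F.vd]
  refine ⟨hK, fun i => ?_, fun j => ?_, fun i => ?_, ?_, fun j i hR => ?_⟩
  · rw [← F.common_v]; exact hcom _ _ (F.va i)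
  · have := hvd j; have := hdeg (F.d j); omega
  · have := hva i; have := hdeg (F.a i); omega
  · have h1 := sum_vdeg (G := G)
    rw [F.sum_eq, hvv, hE, Finset.sum_congr rfl fun i _ => hva i, Finset.sum_add_distrib,
      Finset.sum_add_distrib] at h1
    have h3 := sum_cnt_comm F.R
    have h2 := Finset.sum_congr (rfl : (Finset.univ : Finset (Fin 6)) = _) fun j _ => hvd j
    rw [Finset.sum_add_distrib, Finset.sum_add_distrib] at h2
    simp only [Finset.sum_const, Finset.card_univ, Fintype.card_fin, smul_eq_mul] at h1 h2
    omega
  · have h1 := F.common_d hR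
    have h2 := hcom _ _ (F.R_iff.1 hR)
    omega

/-- Sets of non-neighbours of `v` with diameter at most two are connected. -/
theorem induce_image_connected {J : Set (Fin 6)} (hne : J.Nonempty)
    (h : ∀ j ∈ J, ∀ k ∈ J, j ≠ k → F.C j k = true →
      ∃ l ∈ J, l ≠ j ∧ l ≠ k ∧ F.C j l = false ∧ F.C l k = false) :
    (G.induce (F.d '' J)).Connected := by
  rw [connected_iff_exists_forall_reachable]
  obtain ⟨j, hj⟩ := hne
  refine ⟨⟨F.d j, j, hj, rfl⟩, ?_⟩
  rintro ⟨_, k, hk, rfl⟩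
  by_cases hjk : j = k
  · subst hjk; exact Reachable.refl _
  cases hC : F.C j k
  · exact Adj.reachable (by exact F.adj_of_C hjk hC)
  · obtain ⟨l, hl, hlj, hlk, h1, h2⟩ := h j hj k hk hjk hC
    have a1 : (G.induce (F.d '' J)).Adj ⟨F.d j, j, hj, rfl⟩ ⟨F.d l, l, hl, rfl⟩ :=
      F.adj_of_C hlj.symm h1
    have a2 : (G.induce (F.d '' J)).Adj ⟨F.d l, l, hl, rfl⟩ ⟨F.d k, k, hk, rfl⟩ :=
      F.adj_of_C hlk h2
    exact a1.reachable.trans a2.reachable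

theorem induce_singleton (u : Fin 6) : (G.induce (F.d '' {u})).Connected := by
  rw [Set.image_singleton]; exact induce_singleton_connected _

/-- Two disjoint connected sets of non-neighbours, the first attached to `p` and `p'` and
the second to `q` and `q'`, can be combined with the six neighbours `p, q, x, y, z, t` of `v` to a
`K₆` model. -/
def Crossing (H : Fin 6 → Fin 6 → Bool) (p p' q q' x y z t : Fin 6) : Bool :=
  decide ([p, q, x, y, z, t].Nodup) && H p q && H x y && H z t && (H x z || H x t) &&
  (H y z || H y t) && (H p x || p' == x) && (H p y || p' == y) &&
  (H p z || H p t || p' == z || p' == t) &&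
  (H q x || q' == x) && (H q y || q' == y) && (H q z || H q t || q' == z || q' == t)

theorem a_notMem_image (i : Fin 6) (J : Set (Fin 6)) : F.a i ∉ F.d '' J := by
  rintro ⟨j, -, h⟩; exact F.a_ne_d i j h.symm

theorem v_notMem_image (J : Set (Fin 6)) : F.v ∉ F.d '' J := by
  rintro ⟨j, -, h⟩; exact F.v_ne_d j h.symm

theorem a_notMem_insert {i p : Fin 6} (h : i ≠ p) (J : Set (Fin 6)) :
    F.a i ∉ insert (F.a p) (F.d '' J) := by
  rintro (h' | h')
  · exact h (F.a_inj h')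
  · exact F.a_notMem_image i J h'

theorem v_notMem_insert (p : Fin 6) (J : Set (Fin 6)) :
    F.v ∉ insert (F.a p) (F.d '' J) := by
  rintro (h' | h')
  · exact (F.va p).ne h'
  · exact F.v_notMem_image J h'

theorem hasK6_of_crossing {p p' q q' x y z t : Fin 6} (h : Crossing F.H p p' q q' x y z t = true)
    {J K : Set (Fin 6)} (hJK : Disjoint J K) (hJ : (G.induce (F.d '' J)).Connected)
    (hK : (G.induce (F.d '' K)).Connected)
    (hp : ∃ j ∈ J, F.R j p = true) (hp' : ∃ j ∈ J, F.R j p' = true)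
    (hq : ∃ j ∈ K, F.R j q = true) (hq' : ∃ j ∈ K, F.R j q' = true) : HasK6 G := by
  simp only [Crossing, Bool.and_eq_true, decide_eq_true_eq, Bool.or_eq_true, F.H_iff, beq_iff_eq,
    List.nodup_cons, List.mem_cons, List.not_mem_nil, not_or] at h
  obtain ⟨⟨⟨⟨⟨⟨⟨⟨⟨⟨⟨hnd, hpq⟩, hxy⟩, hzt⟩, hx⟩, hy⟩, hpx⟩, hpy⟩, hpz⟩, hqx⟩, hqy⟩, hqz⟩ := h
  simp only [F.R_iff] at hp hp' hq hq'
  obtain ⟨⟨npq, npx, npy, npz, npt, -⟩, ⟨nqx, nqy, nqz, nqt, -⟩, ⟨nxy, nxz, nxt, -⟩,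
    ⟨nyz, nyt, -⟩, ⟨nzt, -⟩, -⟩ := hnd
  have inj : ∀ {i k : Fin 6}, i ≠ k → F.a i ≠ F.a k := fun h h' => h (F.a_inj h')
  have touch : ∀ {L : Set (Fin 6)} {r r' w : Fin 6}, (∃ j ∈ L, G.Adj (F.d j) (F.a r')) →
      (G.Adj (F.a r) (F.a w) ∨ r' = w) → ∃ u ∈ insert (F.a r) (F.d '' L), G.Adj u (F.a w) := by
    rintro L r r' w ⟨j, hj, hjr⟩ (h | rfl)
    · exact ⟨F.a r, Or.inl rfl, h⟩
    · exact ⟨F.d j, Or.inr ⟨j, hj, rfl⟩, hjr⟩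
  have touch2 : ∀ {L : Set (Fin 6)} {r r' w w' : Fin 6}, (∃ j ∈ L, G.Adj (F.d j) (F.a r')) →
      (((G.Adj (F.a r) (F.a w) ∨ G.Adj (F.a r) (F.a w')) ∨ r' = w) ∨ r' = w') →
      ∃ u ∈ insert (F.a r) (F.d '' L), G.Adj u (F.a w) ∨ G.Adj u (F.a w') := by
    rintro L r r' w w' ⟨j, hj, hjr⟩ ((h | rfl) | rfl)
    · exact ⟨F.a r, Or.inl rfl, h⟩
    · exact ⟨F.d j, Or.inr ⟨j, hj, rfl⟩, Or.inl hjr⟩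
    · exact ⟨F.d j, Or.inr ⟨j, hj, rfl⟩, Or.inr hjr⟩
  have conn : ∀ {L : Set (Fin 6)} {r : Fin 6}, (G.induce (F.d '' L)).Connected →
      (∃ j ∈ L, G.Adj (F.d j) (F.a r)) → (G.induce (insert (F.a r) (F.d '' L))).Connected := by
    rintro L r hL ⟨j, hj, hjr⟩
    exact induce_insert_connected hL ⟨j, hj, rfl⟩ hjr.symm
  refine hasK6_of_model (v := F.v) (p := F.a p) (q := F.a q) (x := F.a x) (y := F.a y)
    (z := F.a z) (t := F.a t) (P := insert (F.a p) (F.d '' J)) (Q := insert (F.a q) (F.d '' K))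
    (conn hJ hp) (conn hK hq) (Or.inl rfl) (Or.inl rfl) (F.v_notMem_insert _ _)
    (F.v_notMem_insert _ _) ?_
    (F.a_notMem_insert (Ne.symm npx) _) (F.a_notMem_insert (Ne.symm npy) _)
    (F.a_notMem_insert (Ne.symm npz) _) (F.a_notMem_insert (Ne.symm npt) _)
    (F.a_notMem_insert (Ne.symm nqx) _) (F.a_notMem_insert (Ne.symm nqy) _)
    (F.a_notMem_insert (Ne.symm nqz) _) (F.a_notMem_insert (Ne.symm nqt) _)
    (inj nxz) (inj nxt) (inj nyz) (inj nyt) (F.va t).ne (F.va p) (F.va q) (F.va x) (F.va y) (F.va z)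
    hxy hzt hx hy ⟨F.a p, Or.inl rfl, F.a q, Or.inl rfl, hpq⟩
    (touch hp' hpx) (touch hp' hpy) (touch2 hp' hpz) (touch hq' hqx) (touch hq' hqy)
    (touch2 hq' hqz)
  rw [Set.disjoint_left]
  rintro _ (rfl | ⟨j, hj, rfl⟩) (h | ⟨k, hk, h⟩)
  · exact npq (F.a_inj h)
  · exact F.a_ne_d p k h.symm
  · exact F.a_ne_d q j h.symm
  · have := F.d_inj h
    subst this
    exact Set.disjoint_left.1 hJK hj hk

/-- Three pairwise adjacent neighbours `x, y, s` of `v`, all attached to an edge `t w` of the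
neighbourhood. -/
def KFour (H : Fin 6 → Fin 6 → Bool) (x y s t w : Fin 6) : Bool :=
  H x y && H x s && H y s && H t w && (H x t || H x w) && (H y t || H y w) && (H s t || H s w)

theorem hasK6_of_kFour {a x y s t w : Fin 6} (hnd : [a, x, y, s, t, w].Nodup)
    (h : KFour F.H x y s t w = true) {P : Set V} (hP : (G.induce P).Connected)
    (haP : F.a a ∈ P) (hsub : ∃ J, P ⊆ insert (F.a a) (F.d '' J))
    (hcov : ∀ i, i ≠ a → ∃ u ∈ P, G.Adj u (F.a i)) : HasK6 G := by
  simp only [KFour, Bool.and_eq_true, Bool.or_eq_true, F.H_iff] at h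
  simp only [List.nodup_cons, List.mem_cons, List.not_mem_nil, not_or] at hnd
  obtain ⟨⟨⟨⟨⟨⟨hxy, hxs⟩, hys⟩, htw⟩, hx⟩, hy⟩, hs⟩ := h
  obtain ⟨⟨nax, nay, nas, nat, naw, -⟩, ⟨nxy, nxs, nxt, nxw, -⟩, ⟨nys, nyt, nyw, -⟩,
    ⟨nst, nsw, -⟩, ⟨ntw, -⟩, -⟩ := hnd
  obtain ⟨J, hJ⟩ := hsub
  have inj : ∀ {i k : Fin 6}, i ≠ k → F.a i ≠ F.a k := fun h h' => h (F.a_inj h')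
  have hout : ∀ {i : Fin 6}, a ≠ i → F.a i ∉ P := fun h h' =>
    F.a_notMem_insert (Ne.symm h) J (hJ h')
  obtain ⟨u, hu, hus⟩ := hcov s (Ne.symm nas)
  obtain ⟨u', hu', hut⟩ := hcov t (Ne.symm nat)
  exact hasK6_of_model (v := F.v) (p := F.a a) (q := F.a s) (x := F.a x) (y := F.a y)
    (z := F.a t) (t := F.a w) (P := P) (Q := {F.a s})
    hP (induce_singleton_connected _) haP rfl (fun h => F.v_notMem_insert a J (hJ h))
    (F.va s).ne (Set.disjoint_singleton_right.2 (hout nas)) (hout nax) (hout nay) (hout nat)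
    (hout naw) (inj nxs) (inj nys) (inj (Ne.symm nst)) (inj (Ne.symm nsw)) (inj nxt) (inj nxw)
    (inj nyt) (inj nyw) (F.va w).ne (F.va a) (F.va s) (F.va x) (F.va y) (F.va t) hxy htw hx hy
    ⟨u, hu, _, rfl, hus⟩ (hcov x (Ne.symm nax)) (hcov y (Ne.symm nay)) ⟨u', hu', Or.inl hut⟩
    ⟨_, rfl, hxs.symm⟩ ⟨_, rfl, hys.symm⟩ ⟨_, rfl, hs⟩

end Frame

theorem exists_perm_three {u j k : Fin 6} (huj : u ≠ j) (huk : u ≠ k) (hjk : j ≠ k) :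
    ∃ σ : Equiv.Perm (Fin 6), σ 0 = u ∧ σ 1 = j ∧ σ 2 = k := by
  obtain ⟨σ, hσ⟩ := Equiv.Perm.exists_extending_pair (![0, 1, 2] : Fin 3 → Fin 6) ![u, j, k]
    (by decide) (by
      intro a b hab
      fin_cases a <;> fin_cases b <;> simp_all [eq_comm])
  exact ⟨σ, by simpa using hσ 0, by simpa using hσ 1, by simpa using hσ 2⟩

theorem cnt_perm (f : Fin 6 → Bool) (σ : Equiv.Perm (Fin 6)) : cnt (fun k => f (σ k)) = cnt f :=
  Equiv.sum_comp σ fun k => (f k).toNat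

/-- Counting non-edges around two non-adjacent vertices without common neighbour outside `u`. -/
theorem cnt_bounds {C : Fin 6 → Fin 6 → Bool} (hs : ∀ i k, C i k = C k i) {u j k : Fin 6}
    (huj : u ≠ j) (huk : u ≠ k) (hjk : j ≠ k) (hC : C j k = true)
    (h : ∀ l, l ≠ u → l ≠ j → l ≠ k → C j l = true ∨ C l k = true) :
    5 ≤ cnt (C j) + cnt (C k) ∧ 2 * cnt (C u) + 8 ≤ ∑ i, cnt (C i) + 2 * (C u u).toNat := by
  obtain ⟨σ, h0, h1, h2⟩ := exists_perm_three huj huk hjk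
  let C' := fun i l => C (σ i) (σ l)
  have hs' : ∀ i l, C' i l = C' l i := fun i l => hs _ _
  have hcnt : ∀ i, cnt (C (σ i)) = cnt (C' i) := fun i => (cnt_perm _ σ).symm
  have hsum : ∑ i, cnt (C i) = ∑ i, cnt (C' i) := by
    rw [← Equiv.sum_comp σ]; exact Finset.sum_congr rfl fun i _ => hcnt i
  have hC' : C' 1 2 = true := by simp only [C', h1, h2, hC]
  have hl : ∀ l, l ≠ 0 → l ≠ 1 → l ≠ 2 → 1 ≤ (C' 1 l).toNat + (C' 2 l).toNat := by
    intro l l0 l1 l2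
    rw [hs' 2 l]
    have hne : ∀ m, l ≠ m → σ l ≠ σ m := fun m hm h => hm (σ.injective h)
    rcases h (σ l) (h0 ▸ hne 0 l0) (h1 ▸ hne 1 l1) (h2 ▸ hne 2 l2) with h | h
    · have : C' 1 l = true := by simp only [C', h1, h]
      rw [this]; simp
    · have : C' l 2 = true := by simp only [C', h2, h]
      rw [this]; simp
  have h3 := hl 3 (by decide) (by decide) (by decide)
  have h4 := hl 4 (by decide) (by decide) (by decide)
  have h5 := hl 5 (by decide) (by decide) (by decide)
  have hu : C u u = C' 0 0 := by simp only [C', h0]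
  have hCu : C u = C (σ 0) := by rw [h0]
  have hCj : C j = C (σ 1) := by rw [h1]
  have hCk : C k = C (σ 2) := by rw [h2]
  rw [hsum, hu, hCu, hCj, hCk, hcnt, hcnt, hcnt]
  clear_value C'
  simp only [cnt, Fin.sum_univ_six]
  rw [hs' 1 0, hs' 2 0, hs' 2 1, hs' 3 0, hs' 3 1, hs' 3 2, hs' 4 0, hs' 4 1, hs' 4 2, hs' 5 0,
    hs' 5 1, hs' 5 2, hC', Bool.toNat_true]
  constructor <;> omega

namespace Frame

variable {V : Type} {G : SimpleGraph V} {F : Frame G}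

theorem Critical.sum_C_le (hF : F.Critical) : ∑ j, cnt (F.C j) ≤ 12 := by
  have h1 : ∑ j, (cnt (F.C j) + 1) ≤ ∑ j, cnt (F.R j) := Finset.sum_le_sum fun j _ => hF.C_lt_R j
  have h2 : ∑ _i : Fin 6, 3 ≤ ∑ i, cnt (F.H i) := Finset.sum_le_sum fun i _ => hF.three_le_H i
  have h3 := hF.sum_C
  rw [Finset.sum_add_distrib] at h1
  simp only [Finset.sum_const, Finset.card_univ, Fintype.card_fin, smul_eq_mul] at h1 h2
  omega

theorem Critical.connected_ne (hF : F.Critical) {u : Fin 6}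
    (hu : 3 ≤ cnt (F.C u) ∨ ∀ j, cnt (F.C j) ≤ 2) :
    (G.induce (F.d '' {j | j ≠ u})).Connected := by
  refine F.induce_image_connected ⟨u + 1, by clear hu; revert u; decide⟩ ?_
  intro j hj k hk hjk hC
  by_contra! h
  have hb := cnt_bounds F.C_symm (u := u) (Ne.symm hj) (Ne.symm hk) hjk hC (by
    intro l hlu hlj hlk
    cases h1 : F.C j l
    · have := h l hlu hlj hlk h1
      exact Or.inr (by simpa using this)
    · exact Or.inl rfl)
  have h12 := hF.sum_C_le
  rw [F.C_self, Bool.toNat_false] at hb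
  rcases hu with hu | hu
  · omega
  · have := hu j; have := hu k; omega

theorem H_of_cnt {i : Fin 6} (h : 5 ≤ cnt (F.H i)) (k : Fin 6) (hk : k ≠ i) : F.H i k = true := by
  by_contra hne
  have h1 : cnt (F.H i) ≤ cnt fun l => decide (l ≠ i ∧ l ≠ k) := cnt_mono fun l hl => by
    rw [decide_eq_true_eq]
    refine ⟨?_, ?_⟩
    · rintro rfl; rw [F.H_self] at hl; simp at hl
    · rintro rfl; exact hne hl
  have h2 : ∀ i k : Fin 6, k ≠ i → cnt (fun l => decide (l ≠ i ∧ l ≠ k)) = 4 := by decide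
  have := h2 i k hk
  omega

/-- Some connected set of non-neighbours of `v` is attached to every neighbour that is not
adjacent to all other neighbours. -/
theorem Critical.exists_cover (hF : F.Critical) : ∃ J : Set (Fin 6),
    (G.induce (F.d '' J)).Connected ∧ ∀ i, cnt (F.H i) ≤ 4 → ∃ j ∈ J, F.R j i = true := by
  obtain ⟨u, hu⟩ : ∃ u : Fin 6, 3 ≤ cnt (F.C u) ∨ ∀ j, cnt (F.C j) ≤ 2 := by
    by_cases h : ∃ u, 3 ≤ cnt (F.C u)
    · obtain ⟨u, hu⟩ := h; exact ⟨u, Or.inl hu⟩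
    · push Not at h
      exact ⟨0, Or.inr fun j => by have := h j; omega⟩
  have hconn := hF.connected_ne hu
  by_cases hk : ∃ k, k ≠ u ∧ F.C u k = false
  · obtain ⟨k, hku, hC⟩ := hk
    refine ⟨Set.univ, ?_, fun i hi => ?_⟩
    · have := induce_insert_connected hconn ⟨k, hku, rfl⟩ (F.adj_of_C hku.symm hC)
      have huniv : insert u {j | j ≠ u} = (Set.univ : Set (Fin 6)) := by
        ext j
        simpa using em (j = u)
      rwa [← Set.image_insert_eq, huniv] at this
    · have := hF.five_le i
      obtain ⟨j, hj⟩ := exists_of_cnt_pos (f := fun j => F.R j i) (by omega)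
      exact ⟨j, trivial, hj⟩
  · push Not at hk
    refine ⟨{u}, F.induce_singleton u, fun i _ => ⟨u, rfl, ?_⟩⟩
    by_contra hne
    have h1 : cnt (fun l => decide (l ≠ u)) ≤ cnt (F.C u) := cnt_mono fun l hl => by
      simpa using hk l (by simpa using hl)
    have h2 : cnt (F.R u) ≤ cnt (fun l => decide (l ≠ i)) := cnt_mono fun l hl => by
      rw [decide_eq_true_eq]
      rintro rfl
      exact hne hl
    have h3 : ∀ u : Fin 6, cnt (fun l => decide (l ≠ u)) = 5 := by decide
    have := h3 u
    have := h3 i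
    have := hF.C_lt_R u
    omega

theorem Critical.not_kFour (hF : F.Critical) {a x y s t w : Fin 6}
    (hnd : [a, x, y, s, t, w].Nodup) : KFour F.H x y s t w = false := by
  rw [← Bool.not_eq_true]
  intro h
  obtain ⟨J, hJ, hcov⟩ := hF.exists_cover
  by_cases ha : ∃ j ∈ J, F.R j a = true
  · obtain ⟨j, hj, hja⟩ := ha
    refine hF.noK6 (F.hasK6_of_kFour hnd h (P := insert (F.a a) (F.d '' J))
      (induce_insert_connected hJ ⟨j, hj, rfl⟩ (F.R_iff.1 hja).symm) (Or.inl rfl)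
      ⟨J, subset_rfl⟩ fun i hi => ?_)
    by_cases hi4 : cnt (F.H i) ≤ 4
    · obtain ⟨k, hk, hki⟩ := hcov i hi4
      exact ⟨F.d k, Or.inr ⟨k, hk, rfl⟩, F.R_iff.1 hki⟩
    · have := H_of_cnt (F := F) (i := i) (by omega) a hi.symm
      exact ⟨F.a a, Or.inl rfl, (F.H_iff.1 this).symm⟩
  · have ha5 : 5 ≤ cnt (F.H a) := by
      by_contra hlt
      exact ha (hcov a (by omega))
    refine hF.noK6 (F.hasK6_of_kFour hnd h (P := {F.a a}) (induce_singleton_connected _) rfl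
      ⟨∅, by simp⟩ fun i hi => ⟨F.a a, rfl, F.H_iff.1 (H_of_cnt ha5 i hi)⟩)

end Frame

/-! Relations on `Fin 6` as 36-bit masks: the entry `(i, k)` is bit `6 * i + k`. -/

/-- Inclusion of bit masks. -/
def SubMask (m M : ℕ) : Prop := ∀ n, m.testBit n = true → M.testBit n = true

theorem subMask_zero (M : ℕ) : SubMask 0 M := fun n h => by simp at h

theorem SubMask.lor {m e M : ℕ} (h : SubMask m M) (h' : SubMask e M) : SubMask (m ||| e) M := by
  intro n hn
  rw [Nat.testBit_or, Bool.or_eq_true] at hn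
  exact hn.elim (h n) (h' n)

/-- The mask of a relation. -/
def relMask (C : Fin 6 → Fin 6 → Bool) : ℕ :=
  Nat.ofBits fun n : Fin (6 * 6) => C n.divNat n.modNat

theorem relMask_testBit (C : Fin 6 → Fin 6 → Bool) (i k : Fin 6) :
    (relMask C).testBit (6 * i + k) = C i k := by
  have h : 6 * i.1 + k.1 < 6 * 6 := by omega
  rw [relMask, Nat.testBit_ofBits_lt _ _ h]
  congr 1
  · ext
    show (6 * i.1 + k.1) / 6 = i.1
    omega
  · ext
    show (6 * i.1 + k.1) % 6 = k.1
    omega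

theorem exists_of_relMask_testBit {C : Fin 6 → Fin 6 → Bool} {n : ℕ}
    (h : (relMask C).testBit n = true) : ∃ i k : Fin 6, n = 6 * i + k ∧ C i k = true := by
  have hn : n < 36 := by
    by_contra hn
    rw [relMask, Nat.testBit_ofBits_ge _ _ (by omega)] at h
    simp at h
  have : n = 6 * (⟨n / 6, by omega⟩ : Fin 6) + (⟨n % 6, by omega⟩ : Fin 6) := by
    simp only; omega
  refine ⟨_, _, this, ?_⟩
  rw [← relMask_testBit C, ← this, h]

/-- The mask of the unordered pair `{i, k}`. -/
def pairMask (i k : Fin 6) : ℕ := 2 ^ (6 * i.1 + k.1) ||| 2 ^ (6 * k.1 + i.1)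

theorem pairMask_testBit {i k : Fin 6} {n : ℕ} :
    (pairMask i k).testBit n = true ↔ n = 6 * i + k ∨ n = 6 * k + i := by
  rw [pairMask, Nat.testBit_or, Bool.or_eq_true, Nat.testBit_two_pow, Nat.testBit_two_pow,
    decide_eq_true_eq, decide_eq_true_eq, eq_comm, @eq_comm ℕ n (6 * k + i)]

theorem subMask_pairMask {C : Fin 6 → Fin 6 → Bool} (hs : ∀ i k, C i k = C k i) {i k : Fin 6}
    (h : C i k = true) : SubMask (pairMask i k) (relMask C) := by
  intro n hn
  rcases pairMask_testBit.1 hn with rfl | rfl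
  · rw [relMask_testBit, h]
  · rw [relMask_testBit, hs, h]

/-- The number of ones among the six lowest bits, from a table. -/
def pop (x : ℕ) : ℕ :=
  (5266721624626081916652898579601397356032429460333936579656 >>> (3 * x)) % 8

/-- The number of ones in a row of a mask. -/
def rowPop (m u : ℕ) : ℕ := pop ((m >>> (6 * u)) % 64)

theorem pop_eq : ∀ x < 64, pop x = cnt fun k => x.testBit k := by decide +kernel

theorem rowPop_eq (m u : ℕ) : rowPop m u = cnt fun k => m.testBit (6 * u + k) := by
  rw [rowPop, pop_eq _ (Nat.mod_lt _ (by norm_num))]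
  congr 1
  ext k
  rw [show 64 = 2 ^ 6 by norm_num, Nat.testBit_mod_two_pow, Nat.testBit_shiftRight]
  simp

theorem rowPop_relMask (C : Fin 6 → Fin 6 → Bool) (u : Fin 6) :
    rowPop (relMask C) u = cnt (C u) := by
  simp only [rowPop_eq, relMask_testBit]

theorem SubMask.rowPop_le {m M : ℕ} (h : SubMask m M) (u : ℕ) : rowPop m u ≤ rowPop M u := by
  rw [rowPop_eq, rowPop_eq]
  exact cnt_mono fun k hk => h _ hk

/-- Exhaustive search over all unions of the given masks, pruned by `bad`. -/
def search (bad leaf : ℕ → Bool) : List ℕ → ℕ → Bool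
  | [], m => leaf m
  | e :: es, m => search bad leaf es m && (bad (m ||| e) || search bad leaf es (m ||| e))

theorem search_sound {bad leaf : ℕ → Bool} {M : ℕ} (hbad : ∀ m, SubMask m M → bad m = false)
    (es : List ℕ) (m : ℕ) (hm : SubMask m M)
    (hes : ∀ e ∈ es, SubMask e M ∨ ∀ n, e.testBit n = true → M.testBit n = false)
    (hcov : ∀ n, M.testBit n = true → m.testBit n = true ∨ ∃ e ∈ es, e.testBit n = true)
    (h : search bad leaf es m = true) : leaf M = true := by
  induction es generalizing m with
  | nil =>
    have : m = M := Nat.eq_of_testBit_eq fun n => by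
      rw [Bool.eq_iff_iff]
      exact ⟨hm n, fun hn => (hcov n hn).elim id (by simp)⟩
    rw [← this]; exact h
  | cons e es ih =>
    rw [search, Bool.and_eq_true, Bool.or_eq_true] at h
    have hes' := fun e' he' => hes e' (List.mem_cons_of_mem _ he')
    rcases hes e List.mem_cons_self with he | he
    · have hme := hm.lor he
      refine ih _ hme hes' (fun n hn => ?_) (h.2.resolve_left (by simp [hbad _ hme]))
      rw [Nat.testBit_or, Bool.or_eq_true]
      rcases hcov n hn with h1 | ⟨e', he', h1⟩
      · exact Or.inl (Or.inl h1)
      · rcases List.mem_cons.1 he' with rfl | he'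
        · exact Or.inl (Or.inr h1)
        · exact Or.inr ⟨e', he', h1⟩
    · refine ih _ hm hes' (fun n hn => ?_) h.1
      rcases hcov n hn with h1 | ⟨e', he', h1⟩
      · exact Or.inl h1
      · rcases List.mem_cons.1 he' with rfl | he'
        · rw [he n h1] at hn; simp at hn
        · exact Or.inr ⟨e', he', h1⟩

/-- All pairs of indices. -/
def allPairs : List (Fin 6 × Fin 6) :=
  [(0, 1), (0, 2), (0, 3), (0, 4), (0, 5), (1, 2), (1, 3), (1, 4), (1, 5), (2, 3), (2, 4), (2, 5),
    (3, 4), (3, 5), (4, 5)]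

/-- The relation coded by a mask. -/
def ofMask (m : ℕ) (i k : Fin 6) : Bool := m.testBit (6 * i + k)

/-- The complement of the relation coded by a mask. -/
def coMask (m : ℕ) (i k : Fin 6) : Bool := i.1 != k.1 && !m.testBit (6 * i + k)

theorem search_allPairs {bad leaf : ℕ → Bool} {C : Fin 6 → Fin 6 → Bool}
    (hs : ∀ i k, C i k = C k i) (hi : ∀ i, C i i = false)
    (hbad : ∀ m, SubMask m (relMask C) → bad m = false)
    (h : search bad leaf (allPairs.map fun p => pairMask p.1 p.2) 0 = true) :
    leaf (relMask C) = true := by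
  refine search_sound hbad _ 0 (subMask_zero _) ?_ ?_ h
  · intro e he
    obtain ⟨⟨i, k⟩, -, rfl⟩ := List.mem_map.1 he
    cases hC : C i k
    · refine Or.inr fun n hn => ?_
      rcases pairMask_testBit.1 hn with rfl | rfl
      · rw [relMask_testBit, hC]
      · rw [relMask_testBit, hs, hC]
    · exact Or.inl (subMask_pairMask hs hC)
  · intro n hn
    obtain ⟨i, k, rfl, hC⟩ := exists_of_relMask_testBit hn
    have hik : i ≠ k := by rintro rfl; simp [hi] at hC
    have hall : ∀ i k : Fin 6, i ≠ k → (i, k) ∈ allPairs ∨ (k, i) ∈ allPairs := by decide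
    rcases hall i k hik with h | h
    · exact Or.inr ⟨_, List.mem_map.2 ⟨_, h, rfl⟩, pairMask_testBit.2 (Or.inl rfl)⟩
    · exact Or.inr ⟨_, List.mem_map.2 ⟨_, h, rfl⟩, pairMask_testBit.2 (Or.inr rfl)⟩

/-- Backtracking search for an embedding of the relation `B` into `H`; `acc` lists the
images chosen so far. -/
def extend (H B : Fin 6 → Fin 6 → Bool) : List (Fin 6) → List (Fin 6 × Fin 6) → Bool
  | [], _ => true
  | i :: is, acc => (List.finRange 6).any fun x =>
      acc.all (fun p => p.2 != x && H x p.2 == B i p.1) && extend H B is ((i, x) :: acc)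

theorem extend_sound {H B : Fin 6 → Fin 6 → Bool} (is : List (Fin 6)) (acc : List (Fin 6 × Fin 6))
    (hacc : acc.Pairwise fun q p => p.2 ≠ q.2 ∧ H q.2 p.2 = B q.1 p.1)
    (h : extend H B is acc = true) : ∃ l : List (Fin 6 × Fin 6),
      l.map Prod.fst = is.reverse ++ acc.map Prod.fst ∧
      l.Pairwise fun q p => p.2 ≠ q.2 ∧ H q.2 p.2 = B q.1 p.1 := by
  induction is generalizing acc with
  | nil => exact ⟨acc, by simp, hacc⟩
  | cons i is ih =>
    rw [extend, List.any_eq_true] at h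
    obtain ⟨x, -, hx⟩ := h
    rw [Bool.and_eq_true, List.all_eq_true] at hx
    obtain ⟨l, hl, hl'⟩ := ih ((i, x) :: acc) (List.pairwise_cons.2 ⟨fun p hp => by
      simpa using hx.1 p hp, hacc⟩) hx.2
    exact ⟨l, by simp [hl], hl'⟩

theorem exists_perm_of_extend {H B : Fin 6 → Fin 6 → Bool} (hHs : ∀ i k, H i k = H k i)
    (hHi : ∀ i, H i i = false) (hBs : ∀ i k, B i k = B k i) (hBi : ∀ i, B i i = false)
    (h : extend H B (List.finRange 6) [] = true) :
    ∃ σ : Equiv.Perm (Fin 6), ∀ i k, H (σ i) (σ k) = B i k := by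
  obtain ⟨l, hl, hl'⟩ := extend_sound _ [] List.Pairwise.nil h
  have hmem : ∀ i : Fin 6, ∃ x, (i, x) ∈ l := by
    intro i
    have : i ∈ l.map Prod.fst := by rw [hl]; simp
    obtain ⟨⟨_, x⟩, hp, rfl⟩ := List.mem_map.1 this
    exact ⟨x, hp⟩
  choose f hf using hmem
  have h1 : l.Pairwise fun q p => q ≠ p → p.2 ≠ q.2 ∧ H q.2 p.2 = B q.1 p.1 := by
    refine hl'.imp ?_
    intro q p h _
    exact h
  have h2 : l.Pairwise (flip fun q p => q ≠ p → p.2 ≠ q.2 ∧ H q.2 p.2 = B q.1 p.1) := by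
    refine hl'.imp ?_
    intro q p h _
    exact ⟨h.1.symm, by rw [hHs, hBs]; exact h.2⟩
  have key : ∀ ⦃q⦄, q ∈ l → ∀ ⦃p⦄, p ∈ l → q ≠ p → p.2 ≠ q.2 ∧ H q.2 p.2 = B q.1 p.1 :=
    List.Pairwise.forall_of_forall_of_flip (fun x _ hx => absurd rfl hx) h1 h2
  have hinj : Function.Injective f := by
    intro i k hik
    by_contra hne
    exact (key (hf i) (hf k) (by simp [hne])).1 hik.symm
  refine ⟨Equiv.ofBijective f (Finite.injective_iff_bijective.1 hinj), fun i k => ?_⟩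
  simp only [Equiv.ofBijective_apply]
  by_cases hik : i = k
  · subst hik; rw [hHi, hBi]
  · exact (key (hf i) (hf k) (by simp [hik])).2

/-- The complete bipartite graph with parts `{0, 1, 2}` and `{3, 4, 5}`. -/
def bipartite : Fin 6 → Fin 6 → Bool := ofMask 7635701304

/-- The triangular prism with triangles `{0, 1, 2}` and `{3, 4, 5}`. -/
def prism : Fin 6 → Fin 6 → Bool := ofMask 30782403918

/-- The wheel with hub `5` and rim `0, 1, 2, 3, 4`. -/
def wheel : Fin 6 → Fin 6 → Bool := ofMask 33987668338

/-- The ways to split six indices into one, three and two. -/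
def splittings : List (Fin 6 × Fin 6 × Fin 6 × Fin 6 × Fin 6 × Fin 6) :=
  [(2, 3, 4, 5, 0, 1), (3, 2, 4, 5, 0, 1), (4, 2, 3, 5, 0, 1), (5, 2, 3, 4, 0, 1),
    (1, 3, 4, 5, 0, 2), (3, 1, 4, 5, 0, 2), (4, 1, 3, 5, 0, 2), (5, 1, 3, 4, 0, 2),
    (1, 2, 4, 5, 0, 3), (2, 1, 4, 5, 0, 3), (4, 1, 2, 5, 0, 3), (5, 1, 2, 4, 0, 3),
    (1, 2, 3, 5, 0, 4), (2, 1, 3, 5, 0, 4), (3, 1, 2, 5, 0, 4), (5, 1, 2, 3, 0, 4),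
    (1, 2, 3, 4, 0, 5), (2, 1, 3, 4, 0, 5), (3, 1, 2, 4, 0, 5), (4, 1, 2, 3, 0, 5),
    (0, 3, 4, 5, 1, 2), (3, 0, 4, 5, 1, 2), (4, 0, 3, 5, 1, 2), (5, 0, 3, 4, 1, 2),
    (0, 2, 4, 5, 1, 3), (2, 0, 4, 5, 1, 3), (4, 0, 2, 5, 1, 3), (5, 0, 2, 4, 1, 3),
    (0, 2, 3, 5, 1, 4), (2, 0, 3, 5, 1, 4), (3, 0, 2, 5, 1, 4), (5, 0, 2, 3, 1, 4),
    (0, 2, 3, 4, 1, 5), (2, 0, 3, 4, 1, 5), (3, 0, 2, 4, 1, 5), (4, 0, 2, 3, 1, 5),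
    (0, 1, 4, 5, 2, 3), (1, 0, 4, 5, 2, 3), (4, 0, 1, 5, 2, 3), (5, 0, 1, 4, 2, 3),
    (0, 1, 3, 5, 2, 4), (1, 0, 3, 5, 2, 4), (3, 0, 1, 5, 2, 4), (5, 0, 1, 3, 2, 4),
    (0, 1, 3, 4, 2, 5), (1, 0, 3, 4, 2, 5), (3, 0, 1, 4, 2, 5), (4, 0, 1, 3, 2, 5),
    (0, 1, 2, 5, 3, 4), (1, 0, 2, 5, 3, 4), (2, 0, 1, 5, 3, 4), (5, 0, 1, 2, 3, 4),
    (0, 1, 2, 4, 3, 5), (1, 0, 2, 4, 3, 5), (2, 0, 1, 4, 3, 5), (4, 0, 1, 2, 3, 5),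
    (0, 1, 2, 3, 4, 5), (1, 0, 2, 3, 4, 5), (2, 0, 1, 3, 4, 5), (3, 0, 1, 2, 4, 5)]

/-- Whether some row of a mask has more than two ones. -/
def someRowGtTwo (m : ℕ) : Bool := [0, 1, 2, 3, 4, 5].any fun u => Nat.blt 2 (rowPop m u)

/-- Whether the complement of a mask has one of the shapes allowed in a neighbourhood, or
contains `KFour`. -/
def classified (m : ℕ) : Bool :=
  splittings.any (fun q =>
    Frame.KFour (coMask m) q.2.1 q.2.2.1 q.2.2.2.1 q.2.2.2.2.1 q.2.2.2.2.2) ||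
  extend (coMask m) bipartite (List.finRange 6) [] ||
  extend (coMask m) prism (List.finRange 6) [] ||
  extend (coMask m) wheel (List.finRange 6) []

theorem search_classified :
    search someRowGtTwo classified (allPairs.map fun p => pairMask p.1 p.2) 0 = true := by
  decide +kernel

theorem splittings_nodup : ∀ q ∈ splittings,
    [q.1, q.2.1, q.2.2.1, q.2.2.2.1, q.2.2.2.2.1, q.2.2.2.2.2].Nodup := by
  have : (splittings.all fun q =>
      decide [q.1, q.2.1, q.2.2.1, q.2.2.2.1, q.2.2.2.2.1, q.2.2.2.2.2].Nodup) = true := by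
    decide +kernel
  simpa only [List.all_eq_true, decide_eq_true_eq] using this

theorem Frame.Critical.exists_shape {V : Type} {G : SimpleGraph V} {F : Frame G}
    (hF : F.Critical) : ∃ σ : Equiv.Perm (Fin 6),
      (∀ i k, F.H (σ i) (σ k) = bipartite i k) ∨ (∀ i k, F.H (σ i) (σ k) = prism i k) ∨
      ∀ i k, F.H (σ i) (σ k) = wheel i k := by
  let C : Fin 6 → Fin 6 → Bool := fun i k => i.1 != k.1 && !F.H i k
  have hs : ∀ i k, C i k = C k i := fun i k => by
    simp only [C, F.H_symm i k, bne_comm (a := i.1)]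
  have hi : ∀ i, C i i = false := fun i => by simp [C]
  have hrow : ∀ i, cnt (C i) ≤ 2 := fun i => by
    have h1 : cnt (C i) + cnt (F.H i) ≤ cnt (fun k => decide (k ≠ i)) := by
      rw [cnt, cnt, cnt, ← Finset.sum_add_distrib]
      refine Finset.sum_le_sum fun k _ => ?_
      by_cases hk : k = i
      · subst hk; simp [C, F.H_self]
      · have : i.1 ≠ k.1 := fun h => hk (Fin.ext h.symm)
        cases h : F.H i k <;> simp [C, h, hk, bne_iff_ne.2 this]
    have h2 : ∀ u : Fin 6, cnt (fun l => decide (l ≠ u)) = 5 := by decide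
    have := h2 i
    have := hF.three_le_H i
    omega
  have hco : coMask (relMask C) = F.H := by
    funext i k
    rw [coMask, relMask_testBit]
    by_cases hik : i = k
    · subst hik; simp [F.H_self]
    · have : i.1 ≠ k.1 := fun h => hik (Fin.ext h)
      simp [C, bne_iff_ne.2 this]
  have hbad : ∀ m, SubMask m (relMask C) → someRowGtTwo m = false := fun m hm => by
    rw [someRowGtTwo, List.any_eq_false]
    intro u hu
    have h1 := hm.rowPop_le u
    have hu6 : u < 6 := by clear h1; revert u; decide
    have h2 := rowPop_relMask C ⟨u, hu6⟩
    have h3 := hrow ⟨u, hu6⟩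
    simp only at h2
    simp only [Nat.blt_eq]
    omega
  have hleaf := search_allPairs hs hi hbad search_classified
  rw [classified, hco, Bool.or_eq_true, Bool.or_eq_true, Bool.or_eq_true] at hleaf
  have hperm : ∀ B : Fin 6 → Fin 6 → Bool, (∀ i k, B i k = B k i) → (∀ i, B i i = false) →
      extend F.H B (List.finRange 6) [] = true → ∃ σ : Equiv.Perm (Fin 6),
      ∀ i k, F.H (σ i) (σ k) = B i k := fun B h1 h2 h =>
    exists_perm_of_extend F.H_symm F.H_self h1 h2 h
  rcases hleaf with ((h | h) | h) | h
  · rw [List.any_eq_true] at h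
    obtain ⟨q, hq, h⟩ := h
    rw [hF.not_kFour (splittings_nodup q hq)] at h
    simp at h
  · obtain ⟨σ, hσ⟩ := hperm _ (by decide) (by decide) h
    exact ⟨σ, Or.inl hσ⟩
  · obtain ⟨σ, hσ⟩ := hperm _ (by decide) (by decide) h
    exact ⟨σ, Or.inr (Or.inl hσ)⟩
  · obtain ⟨σ, hσ⟩ := hperm _ (by decide) (by decide) h
    exact ⟨σ, Or.inr (Or.inr hσ)⟩

/-- Arguments `p, p', q, q', x, y, z, t` of `Frame.Crossing`. -/
abbrev Octuple := Fin 6 × Fin 6 × Fin 6 × Fin 6 × Fin 6 × Fin 6 × Fin 6 × Fin 6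

/-- `Frame.Crossing` for a tuple. -/
def Octuple.crossing (H : Fin 6 → Fin 6 → Bool) : Octuple → Bool
  | (p, p', q, q', x, y, z, t) => Frame.Crossing H p p' q q' x y z t

/-- The masks of `{p, p'}` and `{q, q'}`. -/
def Octuple.ends : Octuple → ℕ × ℕ
  | (p, p', q, q', _) => (2 ^ p.1 ||| 2 ^ p'.1, 2 ^ q.1 ||| 2 ^ q'.1)

/-- Boolean inclusion of masks. -/
def covers (a b : ℕ) : Bool := Nat.beq (a &&& b) b

theorem testBit_of_covers {a b n : ℕ} (h : covers a b = true) (hn : b.testBit n = true) :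
    a.testBit n = true := by
  have h := Nat.eq_of_beq_eq_true h
  rw [← h, Nat.testBit_and, Bool.and_eq_true] at hn
  exact hn.1

/-- Search for a mask containing one member of each pair, pruned by `bad`. The value is `true`
if there is none. -/
def noHitting (bad : ℕ → Bool) : List (ℕ × ℕ) → ℕ → Bool
  | [], _ => false
  | e :: es, m => bif covers m e.1 || covers m e.2 then noHitting bad es m else
      (bad (m ||| e.1) || noHitting bad es (m ||| e.1)) &&
      (bad (m ||| e.2) || noHitting bad es (m ||| e.2))

theorem noHitting_eq_false {bad : ℕ → Bool} {M : ℕ} (hbad : ∀ m, SubMask m M → bad m = false)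
    (es : List (ℕ × ℕ)) (hes : ∀ e ∈ es, SubMask e.1 M ∨ SubMask e.2 M) (m : ℕ)
    (hm : SubMask m M) : noHitting bad es m = false := by
  induction es generalizing m with
  | nil => rfl
  | cons e es ih =>
    have ih := ih fun e' he' => hes e' (List.mem_cons_of_mem _ he')
    rw [noHitting]
    cases covers m e.1 || covers m e.2
    · rcases hes e List.mem_cons_self with h | h
      · simp [hbad _ (hm.lor h), ih _ (hm.lor h)]
      · simp [hbad _ (hm.lor h), ih _ (hm.lor h)]
    · simpa using ih m hm

/-- Exhaustive search over lists of `n` elements of `opts`, in the order given by `opts`. The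
elements found so far are stored in `acc`. -/
def forallRows (dead : List ℕ → List ℕ → Bool) (leaf : List ℕ → Bool) :
    (fuel n : ℕ) → (opts acc : List ℕ) → Bool
  | 0, _, _, _ => false
  | _ + 1, 0, _, acc => leaf acc
  | _ + 1, _ + 1, [], _ => true
  | f + 1, n + 1, o :: os, acc => dead (o :: os) acc ||
      (forallRows dead leaf f n (o :: os) (o :: acc) && forallRows dead leaf f (n + 1) os acc)

theorem leaf_of_forallRows {dead : List ℕ → List ℕ → Bool} {leaf : List ℕ → Bool} {L : List ℕ}
    (key : ℕ → ℕ)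
    (hdead : ∀ opts rs acc : List ℕ, rs.reverse ++ acc = L → (∀ r ∈ rs, r ∈ opts) →
      dead opts acc = false)
    (f n : ℕ) (opts acc rs : List ℕ) (hlen : rs.length = n) (hmem : ∀ r ∈ rs, r ∈ opts)
    (hrs : rs.Pairwise fun a b => key a ≤ key b) (hopts : opts.Pairwise fun a b => key a < key b)
    (hL : rs.reverse ++ acc = L) (h : forallRows dead leaf f n opts acc = true) :
    leaf L = true := by
  induction f generalizing n opts acc rs with
  | zero => simp [forallRows] at h
  | succ f ih =>
    match n, rs, hlen, opts, h with
    | 0, [], _, _, h => simpa [← hL, forallRows] using h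
    | n + 1, r :: rs, _, [], _ => simpa using hmem r (by simp)
    | n + 1, r :: rs, hlen, o :: os, h =>
      rw [forallRows, hdead _ _ _ hL hmem, Bool.false_or, Bool.and_eq_true] at h
      rw [List.pairwise_cons] at hrs hopts
      by_cases hro : r = o
      · subst hro
        exact ih n _ _ rs (by simpa using hlen) (fun r' hr' => hmem r' (by simp [hr'])) hrs.2
          (List.pairwise_cons.2 hopts) (by simpa using hL) h.1
      · have hr : r ∈ os := by simpa [hro] using hmem r (by simp)
        refine ih (n + 1) os acc (r :: rs) hlen ?_ (List.pairwise_cons.2 hrs) hopts.2 hL h.2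
        intro r' hr'
        have hle : key r ≤ key r' := by
          rcases List.mem_cons.1 hr' with rfl | hr'
          · exact le_rfl
          · exact hrs.1 r' hr'
        have hne : r' ≠ o := by
          rintro rfl
          have := hopts.1 r hr
          omega
        have hr := hmem r' hr'
        simpa [hne] using hr

/-- The number of rows containing `i`. -/
def colCount (rs : List ℕ) (i : ℕ) : ℕ := rs.countP fun r => r.testBit i

/-- Whether some column can no longer get two entries. -/
def colDead (n : ℕ) (opts acc : List ℕ) : Bool :=
  (List.range n).any fun i => Nat.blt (colCount acc i) 2 && !opts.any fun r => r.testBit i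

theorem colDead_eq_false {n : ℕ} {L : List ℕ} (hL : ∀ i < n, 2 ≤ colCount L i)
    (opts rs acc : List ℕ) (h : rs.reverse ++ acc = L) (hmem : ∀ r ∈ rs, r ∈ opts) :
    colDead n opts acc = false := by
  rw [colDead, List.any_eq_false]
  intro i hi hd
  simp only [Bool.and_eq_true, Nat.blt_eq, Bool.not_eq_true', List.any_eq_false] at hd
  have h2 := hL i (List.mem_range.1 hi)
  rw [← h, colCount, List.countP_append, List.countP_reverse] at h2
  have : 0 < rs.countP fun r => r.testBit i := by
    have := hd.1
    rw [colCount] at this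
    omega
  obtain ⟨r, hr, hri⟩ := List.countP_pos_iff.1 this
  exact hd.2 r (hmem r hr) hri

theorem colCount_ofFn (r : Fin 6 → ℕ) (i : ℕ) :
    colCount (List.ofFn r) i = cnt fun j => (r j).testBit i := by
  have : ∀ b : Bool, (if b = true then 1 else 0) = b.toNat := by decide
  simp [colCount, List.ofFn_succ, List.countP_cons, cnt, Fin.sum_univ_succ, this]
  omega

/-- Pairs of pairs of rows that cannot both be adjacent. -/
def crossingPairs (es : List (ℕ × ℕ)) (rs : List ℕ) : List (ℕ × ℕ) :=
  allPairs.flatMap fun p => (allPairs.filter fun q =>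
    p.1 != q.1 && p.1 != q.2 && p.2 != q.1 && p.2 != q.2 &&
    es.any fun e => covers (rs.getD p.1 0 ||| rs.getD p.2 0) e.1 &&
      covers (rs.getD q.1 0 ||| rs.getD q.2 0) e.2).map
    fun q => (pairMask p.1 p.2, pairMask q.1 q.2)

/-- Whether a mask of non-adjacent pairs of rows is too large. -/
def tooLarge (s : ℕ) (rs : List ℕ) (m : ℕ) : Bool :=
  [0, 1, 2, 3, 4, 5].any (fun u => Nat.ble (pop (rs.getD u 0) + s) (rowPop m u)) ||
  Nat.blt (2 * (rs.map pop).sum + 14 * s) (([0, 1, 2, 3, 4, 5].map (rowPop m)).sum + 24)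

/-- Whether a list of rows is incompatible with a frame whose neighbourhood graph has mask `hm`.
Only the first `n` columns are considered, and `s` is the number of neglected columns. -/
def impossible (n s hm : ℕ) (es : List (ℕ × ℕ)) (rs : List ℕ) : Bool :=
  (List.range n).any (fun i => Nat.blt (colCount rs i) 2) ||
  (List.range n).any (fun i => rs.any fun r => r.testBit i &&
    Nat.blt (pop (r &&& ((hm >>> (6 * i)) % 64)) + s + colCount rs i) 4) ||
  noHitting (tooLarge s rs) (crossingPairs es rs) 0

/-- The crossings in the prism that are used. -/
def prismTable : List Octuple :=
  [(0, 4, 1, 3, 3, 4, 5, 2), (0, 5, 2, 3, 3, 5, 4, 1), (1, 5, 2, 4, 4, 5, 3, 0)]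

/-- The crossings in the wheel that are used. -/
def wheelTable : List Octuple :=
  [(0, 2, 1, 3, 5, 2, 3, 4), (0, 2, 1, 4, 5, 2, 3, 4), (1, 3, 2, 4, 5, 3, 4, 0),
    (1, 3, 2, 0, 5, 3, 4, 0), (2, 4, 3, 0, 5, 4, 0, 1), (2, 4, 3, 1, 5, 4, 0, 1),
    (3, 0, 4, 1, 5, 0, 1, 2), (3, 0, 4, 2, 5, 0, 1, 2), (4, 1, 0, 2, 5, 1, 2, 3),
    (4, 1, 0, 3, 5, 1, 2, 3)]

/-- The crossings in the complete bipartite graph that are used. -/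
def bipartiteTable : List Octuple :=
  [(0, 1, 3, 4, 1, 4, 2, 5), (0, 2, 3, 5, 2, 5, 1, 4), (1, 2, 4, 5, 2, 5, 0, 3)]

/-- The rows compatible with `prismTable`. -/
def prismRows : List ℕ := [7, 3, 5, 1, 9, 6, 2, 18, 4, 36, 56, 24, 40, 48, 8, 16, 32]

/-- The rows compatible with `wheelTable`. -/
def wheelRows : List ℕ := [3, 17, 1, 6, 2, 12, 4, 24, 8, 16, 0]

/-- The rows compatible with `bipartiteTable`. -/
def bipartiteRows : List ℕ := [1, 2, 4, 8, 16, 32, 9, 10, 12, 17, 18, 20, 33, 34, 36]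

theorem forallRows_prism : forallRows (colDead 6)
    (impossible 6 0 30782403918 [(17, 10), (33, 12), (34, 20)]) 30 6 prismRows [] = true := by
  decide +kernel

theorem forallRows_wheel : forallRows (colDead 5)
    (fun rs => impossible 5 1 33987668338 [(5, 10), (5, 18), (10, 20), (10, 5), (20, 9), (20, 10),
      (9, 18), (9, 20), (18, 5), (18, 9)] rs || rs == [0, 24, 12, 6, 17, 3]) 30 6 wheelRows [] =
    true := by
  decide +kernel

theorem prismTable_ends : prismTable.map Octuple.ends = [(17, 10), (33, 12), (34, 20)] := by
  decide +kernel

theorem wheelTable_ends : wheelTable.map Octuple.ends = [(5, 10), (5, 18), (10, 20), (10, 5),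
    (20, 9), (20, 10), (9, 18), (9, 20), (18, 5), (18, 9)] := by
  decide +kernel

/-- Facts about a possible neighbourhood graph, with mask `hm`: all rows without the pairs
in `table` are listed in `opts`. -/
structure Shape (n s hm : ℕ) (table : List Octuple) (opts : List ℕ) : Prop where
  dims : (n = 6 ∧ s = 0) ∨ (n = 5 ∧ s = 1)
  crossing : ∀ t ∈ table, t.crossing (ofMask hm) = true
  ends_lt : ∀ t ∈ table, t.1.1 < n ∧ t.2.1.1 < n ∧ t.2.2.1.1 < n ∧ t.2.2.2.1.1 < n
  degree : ∀ i : Fin 6, i.1 < n → rowPop hm i ≤ 3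
  sum_degree : ∑ i : Fin 6, rowPop hm i = 18 + 2 * s
  rows : ∀ x < 2 ^ n, (∀ e ∈ table.map Octuple.ends, covers x e.1 = false ∧
    covers x e.2 = false) → 1 ≤ x + s → x ∈ opts ∧ pop x + s ≤ 3

theorem shape_prism : Shape 6 0 30782403918 prismTable prismRows := by
  constructor <;> decide +kernel

theorem shape_wheel : Shape 5 1 33987668338 wheelTable wheelRows := by
  constructor <;> decide +kernel

theorem shape_bipartite : Shape 6 0 7635701304 bipartiteTable bipartiteRows := by
  constructor <;> decide +kernel

theorem testBit_ends (t : Octuple) : t.ends.1.testBit t.1 = true ∧ t.ends.1.testBit t.2.1 = true ∧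
    t.ends.2.testBit t.2.2.1 = true ∧ t.ends.2.testBit t.2.2.2.1 = true := by
  obtain ⟨p, p', q, q', x⟩ := t
  simp [Octuple.ends, Nat.testBit_or, Nat.testBit_two_pow_self]

theorem Shape.cnt_le {n s hm : ℕ} {table : List Octuple} {opts : List ℕ}
    (S : Shape n s hm table opts) (f : Fin 6 → Bool) :
    cnt f ≤ cnt (fun k => decide (k.1 < n) && f k) + s := by
  have := (f 5).toNat_le
  rcases S.dims with ⟨rfl, rfl⟩ | ⟨rfl, rfl⟩
  · exact cnt_mono (by simp +contextual)
  · simp only [cnt, Fin.sum_univ_six]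
    simp
    omega

namespace Frame

variable {V : Type} {G : SimpleGraph V}

/-- The mask of the neighbours of `d j` among the first `n` neighbours of `v`. -/
noncomputable def row (F : Frame G) (n : ℕ) (j : Fin 6) : ℕ := Nat.ofBits (F.R j) % 2 ^ n

theorem row_testBit (F : Frame G) (n : ℕ) (j i : Fin 6) :
    (F.row n j).testBit i = (decide (i.1 < n) && F.R j i) := by
  rw [row, Nat.testBit_mod_two_pow, Nat.testBit_ofBits_lt _ _ i.2]

theorem R_of_row_testBit {F : Frame G} {n : ℕ} {j i : Fin 6}
    (h : (F.row n j).testBit i = true) : F.R j i = true := by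
  rw [row_testBit, Bool.and_eq_true] at h
  exact h.2

theorem row_lt (F : Frame G) (n : ℕ) (j : Fin 6) : F.row n j < 2 ^ n :=
  Nat.mod_lt _ (by positivity)

theorem row_lt_64 (F : Frame G) (n : ℕ) (j : Fin 6) : F.row n j < 64 :=
  (Nat.mod_le _ _).trans_lt (Nat.ofBits_lt_two_pow _)

theorem pop_row (F : Frame G) (n : ℕ) (j : Fin 6) :
    pop (F.row n j) = cnt fun k => decide (k.1 < n) && F.R j k := by
  rw [pop_eq _ (F.row_lt_64 n j)]
  simp only [row_testBit]

theorem induce_pair {F : Frame G} {i j : Fin 6} (h : F.C i j = false) :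
    (G.induce (F.d '' {i, j})).Connected := by
  refine F.induce_image_connected ⟨i, Or.inl rfl⟩ ?_
  rintro a (rfl | rfl) b (rfl | rfl) hab hC
  · exact absurd rfl hab
  · rw [h] at hC; simp at hC
  · rw [F.C_symm, h] at hC; simp at hC
  · exact absurd rfl hab

/-- A critical frame whose neighbourhood graph is the one described by a shape. -/
structure Fits (F : Frame G) (n s hm : ℕ) (table : List Octuple) (opts : List ℕ) : Prop where
  shape : Shape n s hm table opts
  critical : F.Critical
  H_eq : ∀ i k, F.H i k = ofMask hm i k

namespace Fits

variable {n s hm : ℕ} {table : List Octuple} {opts : List ℕ} {F : Frame G}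

theorem cnt_H_eq (P : F.Fits n s hm table opts) (i : Fin 6) : cnt (F.H i) = rowPop hm i := by
  rw [rowPop_eq]
  congr 1
  ext k
  rw [P.H_eq, ofMask]

theorem two_le_col (P : F.Fits n s hm table opts) {i : Fin 6} (hi : i.1 < n) :
    2 ≤ cnt fun j => F.R j i := by
  have := P.critical.five_le i
  have := P.shape.degree i hi
  have := P.cnt_H_eq i
  omega

theorem noCrossing (P : F.Fits n s hm table opts) {t : Octuple} (ht : t ∈ table)
    {J K : Set (Fin 6)} (hJK : Disjoint J K)
    (hJ : (G.induce (F.d '' J)).Connected) (hK : (G.induce (F.d '' K)).Connected)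
    (hp : ∃ j ∈ J, F.R j t.1 = true) (hp' : ∃ j ∈ J, F.R j t.2.1 = true)
    (hq : ∃ j ∈ K, F.R j t.2.2.1 = true) (hq' : ∃ j ∈ K, F.R j t.2.2.2.1 = true) : False := by
  have hc := P.shape.crossing t ht
  have : F.H = ofMask hm := by funext i k; exact P.H_eq i k
  rw [← this] at hc
  exact P.critical.noK6 (F.hasK6_of_crossing hc hJK hJ hK hp hp' hq hq')

theorem row_spec (P : F.Fits n s hm table opts) {u : Fin 6}
    (hu : 3 ≤ cnt (F.C u) ∨ ∀ j, cnt (F.C j) ≤ 2) :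
    F.row n u ∈ opts ∧ pop (F.row n u) + s ≤ 3 := by
  have hconn := P.critical.connected_ne hu
  have hrest : ∀ i : Fin 6, i.1 < n → ∃ j ∈ {j | j ≠ u}, F.R j i = true := fun i hi =>
    exists_ne_of_cnt (P.two_le_col hi) u
  have hdisj : Disjoint {u} {j | j ≠ u} := by simp
  refine P.shape.rows _ (F.row_lt n u) ?_ ?_
  · intro e he
    obtain ⟨t, ht, rfl⟩ := List.mem_map.1 he
    obtain ⟨l1, l2, l3, l4⟩ := P.shape.ends_lt t ht
    obtain ⟨b1, b2, b3, b4⟩ := testBit_ends t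
    constructor <;> rw [← Bool.not_eq_true] <;> intro h
    · exact P.noCrossing ht hdisj (F.induce_singleton u) hconn
        ⟨u, rfl, R_of_row_testBit (testBit_of_covers h b1)⟩
        ⟨u, rfl, R_of_row_testBit (testBit_of_covers h b2)⟩ (hrest _ l3) (hrest _ l4)
    · exact P.noCrossing ht hdisj.symm hconn (F.induce_singleton u) (hrest _ l1) (hrest _ l2)
        ⟨u, rfl, R_of_row_testBit (testBit_of_covers h b3)⟩
        ⟨u, rfl, R_of_row_testBit (testBit_of_covers h b4)⟩
  · have h1 := P.critical.C_lt_R u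
    have h2 := P.shape.cnt_le (F.R u)
    rw [← pop_row] at h2
    by_contra h
    have h0 : F.row n u = 0 := by omega
    rw [h0, show pop 0 = 0 by decide] at h2
    omega

theorem C_lt_pop (P : F.Fits n s hm table opts) (j : Fin 6) :
    cnt (F.C j) + 1 ≤ pop (F.row n j) + s := by
  have h1 := P.critical.C_lt_R j
  have h2 := P.shape.cnt_le (F.R j)
  rw [← pop_row] at h2
  omega

theorem C_le_two (P : F.Fits n s hm table opts) (j : Fin 6) : cnt (F.C j) ≤ 2 := by
  by_contra h
  have := (P.row_spec (u := j) (Or.inl (by omega))).2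
  have := P.C_lt_pop j
  omega

theorem row_mem (P : F.Fits n s hm table opts) (j : Fin 6) : F.row n j ∈ opts :=
  (P.row_spec (Or.inr (P.C_le_two))).1

theorem sum_C_le_pop (P : F.Fits n s hm table opts) :
    ∑ j, cnt (F.C j) + 24 ≤ 2 * ∑ j, pop (F.row n j) + 14 * s := by
  have h1 := P.critical.sum_C
  rw [Finset.sum_congr rfl fun i _ => P.cnt_H_eq i, P.shape.sum_degree] at h1
  have h2 : ∑ j, cnt (F.R j) ≤ ∑ j, (pop (F.row n j) + s) := Finset.sum_le_sum fun j _ => by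
    rw [pop_row]; exact P.shape.cnt_le _
  rw [Finset.sum_add_distrib] at h2
  simp only [Finset.sum_const, Finset.card_univ, Fintype.card_fin, smul_eq_mul] at h2
  omega

theorem colCount_row (P : F.Fits n s hm table opts) {i : ℕ} (hi : i < n) :
    ∃ h : i < 6, colCount (List.ofFn (F.row n)) i = cnt fun j => F.R j ⟨i, h⟩ := by
  have h6 : i < 6 := by rcases P.shape.dims with ⟨rfl, -⟩ | ⟨rfl, -⟩ <;> omega
  refine ⟨h6, ?_⟩
  rw [colCount_ofFn]
  congr 1
  ext j
  have := F.row_testBit n j ⟨i, h6⟩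
  simpa [hi] using this

theorem two_le_colCount (P : F.Fits n s hm table opts) {i : ℕ} (hi : i < n) :
    2 ≤ colCount (List.ofFn (F.row n)) i := by
  obtain ⟨h6, h⟩ := P.colCount_row hi
  rw [h]
  exact P.two_le_col hi

theorem four_le_pop (P : F.Fits n s hm table opts) {i : ℕ} (hi : i < n) (j : Fin 6)
    (hj : (F.row n j).testBit i = true) :
    4 ≤ pop (F.row n j &&& ((hm >>> (6 * i)) % 64)) + s + colCount (List.ofFn (F.row n)) i := by
  obtain ⟨h6, h⟩ := P.colCount_row hi
  rw [h]
  have h1 := P.critical.triangles j ⟨i, h6⟩ (R_of_row_testBit hj)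
  have h2 := P.shape.cnt_le fun k => F.R j k && F.H ⟨i, h6⟩ k
  rw [pop_eq _ (Nat.and_lt_two_pow _ (n := 6) (Nat.mod_lt _ (by norm_num)))]
  have h3 : (fun k : Fin 6 => (F.row n j &&& ((hm >>> (6 * i)) % 64)).testBit k) =
      fun k => decide (k.1 < n) && (F.R j k && F.H ⟨i, h6⟩ k) := by
    ext k
    rw [Nat.testBit_and, row_testBit, show 64 = 2 ^ 6 by norm_num, Nat.testBit_mod_two_pow,
      Nat.testBit_shiftRight, P.H_eq, ofMask]
    simp [Bool.and_assoc]
  rw [h3]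
  omega

theorem tooLarge_eq_false (P : F.Fits n s hm table opts) {m : ℕ} (hm : SubMask m (relMask F.C)) :
    tooLarge s (List.ofFn (F.row n)) m = false := by
  have hrow : ∀ u : Fin 6, rowPop m u ≤ cnt (F.C u) := fun u =>
    (hm.rowPop_le u).trans (rowPop_relMask F.C u).le
  rw [tooLarge, Bool.or_eq_false_iff]
  constructor
  · rw [List.any_eq_false]
    intro u hu
    have hu6 : u < 6 := by revert u; decide
    have h1 := hrow ⟨u, hu6⟩
    have h2 := P.C_lt_pop ⟨u, hu6⟩
    have h3 : (List.ofFn (F.row n)).getD u 0 = F.row n ⟨u, hu6⟩ := by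
      rw [List.getD_eq_getElem?_getD, List.getElem?_ofFn, dif_pos hu6, Option.getD_some]
    rw [h3, Nat.ble_eq]
    simp only at h1
    omega
  · rw [← Bool.not_eq_true, Nat.blt_eq, not_lt]
    have h1 := P.sum_C_le_pop
    have h2 : ([0, 1, 2, 3, 4, 5].map (rowPop m)).sum ≤ ∑ u, cnt (F.C u) := by
      rw [Fin.sum_univ_six]
      have := hrow 0
      have := hrow 1
      have := hrow 2
      have := hrow 3
      have := hrow 4
      have := hrow 5
      simp at *
      omega
    have h3 : ((List.ofFn (F.row n)).map pop).sum = ∑ j, pop (F.row n j) := by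
      rw [List.map_ofFn, List.sum_ofFn]; rfl
    rw [h3]
    omega

theorem crossingPairs_hit (P : F.Fits n s hm table opts) {e : ℕ × ℕ}
    (he : e ∈ crossingPairs (table.map Octuple.ends) (List.ofFn (F.row n))) :
    SubMask e.1 (relMask F.C) ∨ SubMask e.2 (relMask F.C) := by
  simp only [crossingPairs, List.mem_flatMap, List.mem_map, List.mem_filter, Bool.and_eq_true,
    bne_iff_ne, List.any_eq_true] at he
  obtain ⟨⟨a, b⟩, -, ⟨c, d⟩, ⟨-, ⟨⟨⟨hac, had⟩, hbc⟩, hbd⟩, -, ⟨t, ht, rfl⟩, h1, h2⟩, rfl⟩ := he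
  simp only [List.getD_eq_getElem?_getD, List.getElem?_ofFn, Fin.is_lt, dif_pos, Fin.eta,
    Option.getD_some] at h1 h2 hac had hbc hbd
  have touch : ∀ {a b i : Fin 6}, (F.row n a ||| F.row n b).testBit i = true →
      ∃ j ∈ ({a, b} : Set (Fin 6)), F.R j i = true := fun {a b i} h => by
    rw [Nat.testBit_or, Bool.or_eq_true] at h
    rcases h with h | h
    · exact ⟨a, Or.inl rfl, R_of_row_testBit h⟩
    · exact ⟨b, Or.inr rfl, R_of_row_testBit h⟩
  cases hab : F.C a b
  · cases hcd : F.C c d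
    · exfalso
      obtain ⟨b1, b2, b3, b4⟩ := testBit_ends t
      refine P.noCrossing ht (J := {a, b}) (K := {c, d}) ?_ (induce_pair hab)
        (induce_pair hcd) (touch (testBit_of_covers h1 b1)) (touch (testBit_of_covers h1 b2))
        (touch (testBit_of_covers h2 b3)) (touch (testBit_of_covers h2 b4))
      simp [hac.symm, had.symm, hbc.symm, hbd.symm]
    · exact Or.inr (subMask_pairMask F.C_symm hcd)
  · exact Or.inl (subMask_pairMask F.C_symm hab)

theorem impossible_eq_false (P : F.Fits n s hm table opts) :
    impossible n s hm (table.map Octuple.ends) (List.ofFn (F.row n)) = false := by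
  rw [impossible, Bool.or_eq_false_iff, Bool.or_eq_false_iff]
  refine ⟨⟨?_, ?_⟩, ?_⟩
  · rw [List.any_eq_false]
    intro i hi
    have := P.two_le_colCount (List.mem_range.1 hi)
    rw [Nat.blt_eq]
    omega
  · rw [List.any_eq_false]
    intro i hi h
    rw [List.any_eq_true] at h
    obtain ⟨r, hr, h⟩ := h
    obtain ⟨j, rfl⟩ := List.mem_ofFn.1 hr
    rw [Bool.and_eq_true, Nat.blt_eq] at h
    have := P.four_le_pop (List.mem_range.1 hi) j h.1
    omega
  · exact noHitting_eq_false (fun m hm => P.tooLarge_eq_false hm) _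
      (fun e he => P.crossingPairs_hit he) 0 (subMask_zero _)

theorem leaf_of_sorted (P : F.Fits n s hm table opts) {leaf : List ℕ → Bool} {f : ℕ}
    (hopts : opts.Pairwise fun a b => opts.idxOf a < opts.idxOf b)
    (hsort : ∀ i j, i ≤ j → opts.idxOf (F.row n j) ≤ opts.idxOf (F.row n i))
    (h : forallRows (colDead n) leaf f 6 opts [] = true) : leaf (List.ofFn (F.row n)) = true := by
  refine leaf_of_forallRows opts.idxOf
    (colDead_eq_false fun i hi => P.two_le_colCount hi) f 6 opts []
    (List.ofFn (F.row n)).reverse (by simp) ?_ ?_ hopts (by simp) h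
  · intro r hr
    rw [List.mem_reverse, List.mem_ofFn] at hr
    obtain ⟨j, rfl⟩ := hr
    exact P.row_mem j
  · rw [List.pairwise_reverse, List.pairwise_ofFn]
    exact fun i j hij => hsort i j hij.le

end Fits

theorem exists_sorted (F : Frame G) (n : ℕ) (key : ℕ → ℕ) : ∃ τ : Equiv.Perm (Fin 6),
    ∀ i j, i ≤ j → key ((F.perm 1 τ).row n j) ≤ key ((F.perm 1 τ).row n i) := by
  have hrow : ∀ τ j, (F.perm 1 τ).row n j = F.row n (τ j) := fun τ j => by
    simp only [row]
    congr 2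
  refine ⟨Tuple.sort fun j => OrderDual.toDual (key (F.row n j)), fun i j hij => ?_⟩
  rw [hrow, hrow]
  exact Tuple.monotone_sort (fun j => OrderDual.toDual (key (F.row n j))) hij

end Frame

theorem eq_of_cnt_le {f g : Fin 6 → Bool} (h : ∀ k, g k = true → f k = true)
    (hc : cnt f ≤ cnt g) : f = g := by
  have h1 : ∀ k ∈ Finset.univ, (g k).toNat ≤ (f k).toNat := fun k _ => by
    cases hg : g k
    · simp
    · simp [h k hg]
  have h2 := (Finset.sum_eq_sum_iff_of_le h1).1 (le_antisymm (Finset.sum_le_sum h1) hc)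
  funext k
  have h3 := h2 k (Finset.mem_univ k)
  revert h3
  cases f k <;> cases g k <;> decide

namespace Frame

variable {V : Type} {G : SimpleGraph V}

theorem Fits.perm {n s hm : ℕ} {table : List Octuple} {opts : List ℕ} {F : Frame G}
    (P : F.Fits n s hm table opts) (τ : Equiv.Perm (Fin 6)) (hF : (F.perm 1 τ).Critical) :
    (F.perm 1 τ).Fits n s hm table opts :=
  ⟨P.shape, hF, fun i k => by rw [perm_H]; exact P.H_eq i k⟩

theorem Fits.not_bipartite {F : Frame G} :
    ¬ F.Fits 6 0 7635701304 bipartiteTable bipartiteRows := by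
  intro P
  have hpop : ∀ x ∈ bipartiteRows, pop x ≤ 2 := by decide
  have h1 : ∑ j, pop (F.row 6 j) ≤ ∑ _j : Fin 6, 2 :=
    Finset.sum_le_sum fun j _ => hpop _ (P.row_mem j)
  have h2 := P.sum_C_le_pop
  simp only [Finset.sum_const, Finset.card_univ, Fintype.card_fin, smul_eq_mul] at h1
  have h3 : ∑ j, cnt (F.C j) = 0 := by omega
  rw [Finset.sum_eq_zero_iff] at h3
  refine P.critical.noK6 (hasK6_of_clique F.d fun i j hij => F.adj_of_C hij.ne ?_)
  by_contra hC
  have h4 := h3 i (Finset.mem_univ i)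
  rw [cnt, Finset.sum_eq_zero_iff] at h4
  have h5 := h4 j (Finset.mem_univ j)
  rw [Bool.toNat_eq_zero] at h5
  exact hC h5

theorem Fits.not_prism (hall : ∀ F : Frame G, F.Critical) {F : Frame G} :
    ¬ F.Fits 6 0 30782403918 prismTable prismRows := by
  intro P
  obtain ⟨τ, hτ⟩ := F.exists_sorted 6 prismRows.idxOf
  have P' := P.perm τ (hall _)
  have h1 := P'.leaf_of_sorted (by decide +kernel) hτ forallRows_prism
  have h2 := P'.impossible_eq_false
  rw [prismTable_ends] at h2
  rw [h2] at h1
  exact Bool.false_ne_true h1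

/-- The vertices of a graph in terms of a frame. -/
def point (F : Frame G) : Unit ⊕ Fin 6 ⊕ Fin 6 → V :=
  Sum.elim (fun _ => F.v) (Sum.elim F.a F.d)

theorem point_bijective (F : Frame G) : Function.Bijective F.point := by
  constructor
  · rintro (_ | i | j) (_ | k | l) h
    · rfl
    · exact absurd h (F.va k).ne
    · exact absurd h (F.v_ne_d l)
    · exact absurd h (F.va i).ne'
    · rw [F.a_inj h]
    · exact absurd h (F.a_ne_d i l)
    · exact absurd h.symm (F.v_ne_d j)
    · exact absurd h.symm (F.a_ne_d k j)
    · rw [F.d_inj h]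
  · intro w
    rcases F.cover w with rfl | ⟨i, rfl⟩ | ⟨j, rfl⟩
    · exact ⟨Sum.inl (), rfl⟩
    · exact ⟨Sum.inr (Sum.inl i), rfl⟩
    · exact ⟨Sum.inr (Sum.inr j), rfl⟩

/-- Adjacency of the vertices described by a frame. -/
def pointAdj (H R C : Fin 6 → Fin 6 → Bool) : Unit ⊕ Fin 6 ⊕ Fin 6 → Unit ⊕ Fin 6 ⊕ Fin 6 → Bool
  | .inl _, .inl _ => false
  | .inl _, .inr (.inl _) => true
  | .inl _, .inr (.inr _) => false
  | .inr (.inl _), .inl _ => true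
  | .inr (.inr _), .inl _ => false
  | .inr (.inl i), .inr (.inl k) => H i k
  | .inr (.inl i), .inr (.inr j) => R j i
  | .inr (.inr j), .inr (.inl i) => R j i
  | .inr (.inr j), .inr (.inr l) => j != l && !C j l

theorem adj_point (F : Frame G) (x y : Unit ⊕ Fin 6 ⊕ Fin 6) :
    G.Adj (F.point x) (F.point y) ↔ pointAdj F.H F.R F.C x y = true := by
  rcases x with _ | i | j <;> rcases y with _ | k | l
  · simp [point, pointAdj]
  · simpa [point, pointAdj] using F.va k
  · simpa [point, pointAdj] using F.vd l
  · simpa [point, pointAdj] using (F.va i).symm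
  · exact F.H_iff.symm
  · rw [pointAdj, F.R_iff]; exact G.adj_comm _ _
  · simpa [point, pointAdj] using fun h : G.Adj _ _ => F.vd j h.symm
  · exact F.R_iff.symm
  · by_cases h : j = l
    · subst h; simp [pointAdj]
    · have := F.C_iff (j := j) (k := l)
      simp only [pointAdj, Bool.and_eq_true, bne_iff_ne, Bool.not_eq_true', ← Bool.not_eq_true,
        this]
      simp [h, point]

/-- The labelling of the cone over the icosahedron that corresponds to a frame. -/
def coneLabel : Unit ⊕ Fin 12 → Unit ⊕ Fin 6 ⊕ Fin 6 :=
  Sum.elim (fun _ => .inr (.inl 5))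
    ![.inl (), .inr (.inl 0), .inr (.inl 1), .inr (.inl 2), .inr (.inl 3), .inr (.inl 4),
      .inr (.inr 4), .inr (.inr 5), .inr (.inr 3), .inr (.inr 2), .inr (.inr 1), .inr (.inr 0)]

theorem coneLabel_bijective : Function.Bijective coneLabel := by
  constructor
  · decide +kernel
  · decide +kernel

/-- The edges between the two parts of a frame of the cone over the icosahedron. -/
def coneR : Fin 6 → Fin 6 → Bool := ofMask 38413192736

/-- The non-edges outside the neighbourhood in a frame of the cone over the icosahedron. -/
def coneC : Fin 6 → Fin 6 → Bool := ofMask 6648695296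

theorem ic_adj : ∀ x y, Ic.Adj x y ↔
    pointAdj wheel coneR coneC (coneLabel (.inr x)) (coneLabel (.inr y)) = true := by
  simp only [Ic, fromRel_adj]
  decide +kernel

theorem coneIc_adj (x y : Unit ⊕ Fin 12) : ConeIc.Adj x y ↔
    pointAdj wheel coneR coneC (coneLabel x) (coneLabel y) = true := by
  have h0 : pointAdj wheel coneR coneC (coneLabel (.inl ())) (coneLabel (.inl ())) = false := by
    decide +kernel
  have h1 : ∀ y, pointAdj wheel coneR coneC (coneLabel (.inl ())) (coneLabel (.inr y)) = true := by
    decide +kernel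
  have h2 : ∀ x, pointAdj wheel coneR coneC (coneLabel (.inr x)) (coneLabel (.inl ())) = true := by
    decide +kernel
  rcases x with ⟨⟩ | x <;> rcases y with ⟨⟩ | y
  · simp [ConeIc, h0]
  · simp [ConeIc, h1]
  · simp [ConeIc, h2]
  · rw [← ic_adj]
    simp only [ConeIc, fromRel_adj]
    constructor
    · rintro ⟨-, h⟩
      simpa [Ic.adj_comm y x] using h
    · intro h
      exact ⟨by simpa using h.ne, by simpa [Ic.adj_comm y x] using h⟩

theorem nonempty_iso_coneIc {F : Frame G} (hH : F.H = wheel) (hR : F.R = coneR)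
    (hC : F.C = coneC) : Nonempty (G ≃g ConeIc) := by
  let e : Unit ⊕ Fin 12 ≃ V := Equiv.ofBijective _ (F.point_bijective.comp coneLabel_bijective)
  refine ⟨(RelIso.symm ⟨e, fun {x y} => ?_⟩ : G ≃g ConeIc)⟩
  rw [coneIc_adj, ← hH, ← hR, ← hC, ← F.adj_point]
  rfl

theorem Fits.C_eq_true_of_wheel {F : Frame G} (P : F.Fits 5 1 33987668338 wheelTable wheelRows)
    (h0 : ∀ k, F.C 0 k = false) {x y : Fin 6} (hx : x ≠ 0) (hy : y ≠ 0) {t : Octuple}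
    (ht : t ∈ wheelTable) (hxt : F.R x t.1 = true) (hyt : F.R y t.2.1 = true)
    (h1 : ∃ j, (j ≠ x ∧ j ≠ y) ∧ F.R j t.2.2.1 = true)
    (h2 : ∃ j, (j ≠ x ∧ j ≠ y) ∧ F.R j t.2.2.2.1 = true) : F.C x y = true := by
  by_contra hC
  refine P.noCrossing ht (J := {x, y}) (K := {j | j ≠ x ∧ j ≠ y}) ?_
    (induce_pair (by simpa using hC)) ?_ ⟨x, Or.inl rfl, hxt⟩ ⟨y, Or.inr rfl, hyt⟩ h1 h2
  · rw [Set.disjoint_left]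
    rintro _ (rfl | rfl) ⟨h, h'⟩
    · exact h rfl
    · exact h' rfl
  · refine F.induce_image_connected ⟨0, hx.symm, hy.symm⟩ fun j _ k _ _ hjk => ?_
    refine ⟨0, ⟨hx.symm, hy.symm⟩, ?_, ?_, ?_, h0 k⟩
    · rintro rfl; rw [h0] at hjk; simp at hjk
    · rintro rfl; rw [F.C_symm, h0] at hjk; simp at hjk
    · rw [F.C_symm, h0]

theorem Fits.iso_of_rows {F : Frame G} (P : F.Fits 5 1 33987668338 wheelTable wheelRows)
    (hrows : List.ofFn (F.row 5) = [0, 24, 12, 6, 17, 3]) : Nonempty (G ≃g ConeIc) := by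
  have hrow : ∀ j : Fin 6, F.row 5 j = ![0, 24, 12, 6, 17, 3] j := by
    have : F.row 5 = ![0, 24, 12, 6, 17, 3] := List.ofFn_injective (by rw [hrows]; rfl)
    exact congrFun this
  have hR : ∀ j i : Fin 6, i.1 < 5 → F.R j i = coneR j i := by
    intro j i hi
    have h1 := F.row_testBit 5 j i
    rw [hrow, decide_eq_true hi, Bool.true_and] at h1
    have h2 : ∀ j i : Fin 6, i.1 < 5 →
        (![0, 24, 12, 6, 17, 3] j : ℕ).testBit i = coneR j i := by decide +kernel
    rw [← h1, h2 j i hi]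
  have hcap : ∀ j, cnt (F.C j) ≤ cnt (coneC j) := by
    intro j
    have h1 := P.C_lt_pop j
    rw [hrow] at h1
    have h2 : ∀ j : Fin 6, pop (![0, 24, 12, 6, 17, 3] j) = cnt (coneC j) := by decide +kernel
    rw [h2] at h1
    omega
  have h0 : ∀ k, F.C 0 k = false := by
    intro k
    have h1 := hcap 0
    rw [show cnt (coneC 0) = 0 by decide +kernel, Nat.le_zero, cnt, Finset.sum_eq_zero_iff] at h1
    exact Bool.toNat_eq_zero.1 (h1 k (Finset.mem_univ k))
  have hforce : ∀ x y : Fin 6, x ≠ 0 → y ≠ 0 → ∀ t ∈ wheelTable,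
      (t.1.1 < 5 ∧ t.2.1.1 < 5 ∧ t.2.2.1.1 < 5 ∧ t.2.2.2.1.1 < 5) →
      (coneR x t.1 = true ∧ coneR y t.2.1 = true ∧
        (∃ j, (j ≠ x ∧ j ≠ y) ∧ coneR j t.2.2.1 = true) ∧
        ∃ j, (j ≠ x ∧ j ≠ y) ∧ coneR j t.2.2.2.1 = true) → F.C x y = true := by
    rintro x y hx hy t ht ⟨l1, l2, l3, l4⟩ ⟨h1, h2, ⟨j, hj, h3⟩, k, hk, h4⟩
    exact P.C_eq_true_of_wheel h0 hx hy ht (by rw [hR _ _ l1, h1]) (by rw [hR _ _ l2, h2])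
      ⟨j, hj, by rw [hR _ _ l3, h3]⟩ ⟨k, hk, by rw [hR _ _ l4, h4]⟩
  have hsub : ∀ x y : Fin 6, coneC x y = true → F.C x y = true := by
    have hdec : ∀ x y : Fin 6, coneC x y = true → x ≠ 0 ∧ y ≠ 0 ∧ ∃ t ∈ wheelTable,
        (coneR x t.1 = true ∧ coneR y t.2.1 = true ∧
          (∃ j, (j ≠ x ∧ j ≠ y) ∧ coneR j t.2.2.1 = true) ∧
          ∃ j, (j ≠ x ∧ j ≠ y) ∧ coneR j t.2.2.2.1 = true) := by decide +kernel
    intro x y hxy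
    obtain ⟨hx, hy, t, ht, h⟩ := hdec x y hxy
    exact hforce x y hx hy t ht (P.shape.ends_lt t ht) h
  have hC : F.C = coneC := funext fun j => eq_of_cnt_le (hsub j) (hcap j)
  have hhub : ∀ j, F.R j 5 = true := by
    intro j
    by_contra h
    have h1 := P.critical.C_lt_R j
    have h2 : cnt (F.R j) ≤ pop (F.row 5 j) := by
      rw [pop_row]
      refine cnt_mono fun k hk => ?_
      have : k ≠ 5 := by rintro rfl; exact h hk
      have : k.1 < 5 := by omega
      simp [this, hk]
    have h3 : ∀ j : Fin 6, pop (![0, 24, 12, 6, 17, 3] j) = cnt (coneC j) := by decide +kernel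
    rw [hrow, h3] at h2
    rw [hC] at h1
    omega
  refine nonempty_iso_coneIc (F := F) (funext fun i => funext fun k => P.H_eq i k) ?_ hC
  funext j i
  by_cases hi : i.1 < 5
  · exact hR j i hi
  · have : i = 5 := by omega
    subst this
    rw [hhub, show ∀ j, coneR j 5 = true by decide]

theorem Fits.iso_of_wheel (hall : ∀ F : Frame G, F.Critical) {F : Frame G}
    (P : F.Fits 5 1 33987668338 wheelTable wheelRows) : Nonempty (G ≃g ConeIc) := by
  obtain ⟨τ, hτ⟩ := F.exists_sorted 5 wheelRows.idxOf
  have P' := P.perm τ (hall _)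
  have h1 := P'.leaf_of_sorted (by decide +kernel) hτ forallRows_wheel
  have h2 := P'.impossible_eq_false
  rw [wheelTable_ends] at h2
  rw [h2, Bool.false_or, beq_iff_eq] at h1
  exact P'.iso_of_rows h1

end Frame

/-- A graph on 13 vertices with minimum degree at least 6 and exactly 42
edges contains a `K₆` minor or is isomorphic to `K₁ ∗ Ic`. -/
theorem stmt_10 (G : SimpleGraph (Fin 13)) (hdeg : ∀ v, 6 ≤ vdeg G v)
    (hE : G.edgeSet.ncard = 42) :
    IsMinor (completeGraph (Fin 6)) G ∨ Nonempty (G ≃g ConeIc) := by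
  by_cases hK : HasK6 G
  · exact Or.inl hK
  right
  have hall : ∀ F : Frame G, F.Critical := Frame.critical (by simp) hdeg hE hK
  obtain ⟨v, hv⟩ : ∃ v, vdeg G v = 6 := by
    by_contra! h
    have h1 : ∑ _v : Fin 13, 7 ≤ ∑ v, vdeg G v := Finset.sum_le_sum fun v _ => by
      have := hdeg v
      have := h v
      omega
    rw [sum_vdeg, ecard, hE] at h1
    simp at h1
  obtain ⟨F⟩ := exists_frame (by simp) hv
  obtain ⟨σ, h | h | h⟩ := (hall F).exists_shape
  · exact absurd ⟨shape_bipartite, hall (F.perm σ 1), fun i k => by rw [F.perm_H]; exact h i k⟩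
      Frame.Fits.not_bipartite
  · exact absurd ⟨shape_prism, hall (F.perm σ 1), fun i k => by rw [F.perm_H]; exact h i k⟩
      (Frame.Fits.not_prism hall)
  · exact Frame.Fits.iso_of_wheel hall (F := F.perm σ 1)
      ⟨shape_wheel, hall _, fun i k => by rw [F.perm_H]; exact h i k⟩
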